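/- (Functional Ehrhard inequality.) Let a, b > 0 with a + b ≥ 1 and |a − b| ≤ 1, let Ψ(s) = ∫_{−∞}^s (2π)^{−1/2} e^{−t²/2} dt be the standard Gaussian distribution function, and define H on [0,1]² by H(x,y) = Ψ(a Ψ^{−1}(x) + b Ψ^{−1}(y)) for x, y ∈ (0,1), H(x,y) = 0 if x = 0 or y = 0, H(1,y) = 1 for y ∈ (0,1], H(x,1) = 1 for x ∈ (0,1], and H(0,1) = H(1,0) = 0. Then for every n ≥ 1 and all Borel measurable f, g : ℝⁿ → [0,1], one has ∫_{ℝⁿ} esssup_{y ∈ ℝⁿ} H(f((x−y)/a), g(y/b)) dγ_n(x) ≥ H(∫_{ℝⁿ} f dγ_n, ∫_{ℝⁿ} g dγ_n), where the essential supremum in y is taken with respect to Lebesgue measure on ℝⁿ. -/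

import Mathlib

open MeasureTheory Real Filter

noncomputable section

abbrev Euc (n : ℕ) := EuclideanSpace ℝ (Fin n)

/-- `γ_n`, the standard Gaussian probability measure `(2π)^{−n/2} e^{−|x|²/2} dx` on `ℝⁿ`. -/
def stdGaussian (n : ℕ) : Measure (Euc n) :=
  volume.withDensity fun x =>
    ENNReal.ofReal ((2 * π) ^ (-(n : ℝ) / 2) * Real.exp (-‖x‖ ^ 2 / 2))

section
open ProbabilityTheory Topology

lemma abs_taylor_one_le {F F₁ : ℝ → ℝ} {M : ℝ} (h₁ : ∀ x, HasDerivAt F (F₁ x) x)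
    (hM : ∀ x, |F₁ x| ≤ M) (x d : ℝ) : |F (x + d) - F x| ≤ M * |d| := by
  have := Convex.norm_image_sub_le_of_norm_hasDerivWithin_le (f := F) (f' := F₁) (C := M)
    (s := Set.univ) (x := x) (y := x + d) (fun y _ => (h₁ y).hasDerivWithinAt)
    (fun y _ => hM y) convex_univ trivial trivial
  simpa using this

lemma abs_sub_le_mul_abs_of_deriv_le {G G₁ : ℝ → ℝ} {K d : ℝ} (h : ∀ t, HasDerivAt G (G₁ t) t)
    (hK : ∀ t, |t| ≤ |d| → |G₁ t| ≤ K) : |G d - G 0| ≤ K * |d| := by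
  have := Convex.norm_image_sub_le_of_norm_hasDerivWithin_le (f := G) (f' := G₁) (C := K)
    (s := Metric.closedBall 0 |d|) (x := 0) (y := d) (fun y _ => (h y).hasDerivWithinAt)
    (fun y hy => hK y (by simpa using hy)) (convex_closedBall _ _) (by simp) (by simp)
  simpa using this

lemma abs_taylor_two_le {F F₁ F₂ : ℝ → ℝ} {M : ℝ} (h₁ : ∀ x, HasDerivAt F (F₁ x) x)
    (h₂ : ∀ x, HasDerivAt F₁ (F₂ x) x) (hM : ∀ x, |F₂ x| ≤ M) (x d : ℝ) :
    |F (x + d) - F x - F₁ x * d| ≤ M * |d| ^ 2 := by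
  have hM0 : 0 ≤ M := (abs_nonneg _).trans (hM 0)
  have := abs_sub_le_mul_abs_of_deriv_le (G := fun t => F (x + t) - F₁ x * t)
    (G₁ := fun t => F₁ (x + t) - F₁ x) (K := M * |d|) (d := d)
    (fun t => by
      exact (((h₁ (x + t)).comp_const_add x t).fun_sub
        ((hasDerivAt_id' t).const_mul (F₁ x))).congr_deriv (by ring))
    (fun t ht => (abs_taylor_one_le h₂ hM x t).trans (by gcongr))
  simp only [add_zero, mul_zero, sub_zero] at this
  calc _ = |F (x + d) - F₁ x * d - F x| := by ring_nf
    _ ≤ _ := this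
    _ = _ := by ring

lemma abs_taylor_three_le {F F₁ F₂ F₃ : ℝ → ℝ} {M : ℝ} (h₁ : ∀ x, HasDerivAt F (F₁ x) x)
    (h₂ : ∀ x, HasDerivAt F₁ (F₂ x) x) (h₃ : ∀ x, HasDerivAt F₂ (F₃ x) x)
    (hM : ∀ x, |F₃ x| ≤ M) (x d : ℝ) :
    |F (x + d) - F x - F₁ x * d - F₂ x * d ^ 2 / 2| ≤ M * |d| ^ 3 := by
  have hM0 : 0 ≤ M := (abs_nonneg _).trans (hM 0)
  have := abs_sub_le_mul_abs_of_deriv_le (G := fun t => F (x + t) - F₁ x * t - F₂ x * t ^ 2 / 2)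
    (G₁ := fun t => F₁ (x + t) - F₁ x - F₂ x * t) (K := M * |d| ^ 2) (d := d)
    (fun t => by
      exact ((((h₁ (x + t)).comp_const_add x t).fun_sub
        ((hasDerivAt_id' t).const_mul (F₁ x))).fun_sub
        (((hasDerivAt_pow 2 t).const_mul (F₂ x)).div_const 2)).congr_deriv (by push_cast; ring))
    (fun t ht => (abs_taylor_two_le h₂ h₃ hM x t).trans (by gcongr))
  simp only [add_zero, mul_zero, sub_zero] at this
  calc _ = |F (x + d) - F₁ x * d - F₂ x * d ^ 2 / 2 - (F x - F₂ x * 0 ^ 2 / 2)| := by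
        congr 1; ring
    _ ≤ _ := this
    _ = _ := by ring

/-- The standard Gaussian density on the line. -/
def gpdf (x : ℝ) : ℝ := (√(2 * π))⁻¹ * rexp (-x ^ 2 / 2)

lemma gpdf_eq (x : ℝ) : gpdf x = gaussianPDFReal 0 1 x := by
  simp [gpdf, gaussianPDFReal]

lemma gpdf_pos (x : ℝ) : 0 < gpdf x := by unfold gpdf; positivity

lemma two_add_sq_mul_gpdf_le (x : ℝ) : (2 + x ^ 2) * gpdf x ≤ 1 := by
  have h1 : x ^ 2 / 2 + 1 ≤ rexp (x ^ 2 / 2) := add_one_le_exp _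
  have h2 : rexp (x ^ 2 / 2) * rexp (-x ^ 2 / 2) = 1 := by rw [← Real.exp_add]; simp; ring
  have h3 : (2 : ℝ) ≤ √(2 * π) := by
    apply Real.le_sqrt_of_sq_le
    nlinarith [pi_gt_three]
  have h4 : (√(2 * π))⁻¹ ≤ 2⁻¹ := by gcongr
  have h5 : (2 + x ^ 2) * rexp (-x ^ 2 / 2) ≤ 2 := by
    have := Real.exp_pos (-x ^ 2 / 2)
    nlinarith
  unfold gpdf
  have h6 : 0 ≤ (2 + x ^ 2) * rexp (-x ^ 2 / 2) := by positivity
  calc _ = (√(2 * π))⁻¹ * ((2 + x ^ 2) * rexp (-x ^ 2 / 2)) := by ring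
    _ ≤ 2⁻¹ * 2 := by gcongr
    _ = 1 := by norm_num

lemma gpdf_le_one (x : ℝ) : gpdf x ≤ 1 := by
  nlinarith [two_add_sq_mul_gpdf_le x, gpdf_pos x, mul_nonneg (sq_nonneg x) (gpdf_pos x).le]

lemma abs_gpdf_le_one (x : ℝ) : |gpdf x| ≤ 1 := by
  rw [abs_of_pos (gpdf_pos x)]; exact gpdf_le_one x

lemma hasDerivAt_gpdf (x : ℝ) : HasDerivAt gpdf (-(x * gpdf x)) x := by
  have h : HasDerivAt (fun x : ℝ => -x ^ 2 / 2) (-x) x := by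
    exact (((hasDerivAt_pow 2 x).fun_neg).div_const 2).congr_deriv (by push_cast; ring)
  exact (h.exp.const_mul (√(2 * π))⁻¹).congr_deriv (by unfold gpdf; ring)

lemma hasDerivAt_neg_mul_gpdf (x : ℝ) :
    HasDerivAt (fun x => -(x * gpdf x)) ((x ^ 2 - 1) * gpdf x) x := by
  exact ((hasDerivAt_id' x).fun_mul (hasDerivAt_gpdf x)).fun_neg.congr_deriv (by ring)

lemma abs_mul_gpdf_le (x : ℝ) : |-(x * gpdf x)| ≤ 1 := by
  rw [abs_neg, abs_mul, abs_of_pos (gpdf_pos x)]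
  refine le_trans ?_ (two_add_sq_mul_gpdf_le x)
  have := gpdf_pos x
  gcongr
  nlinarith [sq_abs x, sq_nonneg (|x| - 1)]

lemma abs_sq_sub_one_mul_gpdf_le (x : ℝ) : |(x ^ 2 - 1) * gpdf x| ≤ 1 := by
  rw [abs_mul, abs_of_pos (gpdf_pos x)]
  refine le_trans ?_ (two_add_sq_mul_gpdf_le x)
  have := gpdf_pos x
  gcongr
  rw [abs_le]; constructor <;> nlinarith [sq_nonneg x]

/-- The standard Gaussian distribution function. -/
def gcdf (s : ℝ) : ℝ := ∫ t in Set.Iic s, gpdf t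

lemma integrable_gpdf : Integrable gpdf := by
  simpa [← funext gpdf_eq] using integrable_gaussianPDFReal 0 1

lemma continuous_gpdf : Continuous gpdf := by unfold gpdf; fun_prop

lemma gcdf_eq_cdf (s : ℝ) : gcdf s = cdf (gaussianReal 0 1) s := by
  rw [cdf_eq_real, Measure.real, gaussianReal_apply_eq_integral _ one_ne_zero, ENNReal.toReal_ofReal]
  · simp [gcdf, gpdf_eq]
  · exact integral_nonneg fun x => gaussianPDFReal_nonneg _ _ _

lemma hasDerivAt_gcdf (s : ℝ) : HasDerivAt gcdf (gpdf s) s := by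
  have h : gcdf = fun s => (∫ t in (0 : ℝ)..s, gpdf t) + gcdf 0 := by
    ext s
    rw [gcdf, gcdf, ← intervalIntegral.integral_Iic_sub_Iic integrable_gpdf.integrableOn
        integrable_gpdf.integrableOn]
    ring
  rw [h]
  exact (intervalIntegral.integral_hasDerivAt_right
    (integrable_gpdf.intervalIntegrable) (continuous_gpdf.stronglyMeasurableAtFilter _ _)
    continuous_gpdf.continuousAt).add_const _

lemma continuous_gcdf : Continuous gcdf :=
  continuous_iff_continuousAt.2 fun s => (hasDerivAt_gcdf s).continuousAt

lemma strictMono_gcdf : StrictMono gcdf :=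
  strictMono_of_hasDerivAt_pos hasDerivAt_gcdf gpdf_pos

lemma tendsto_gcdf_atBot : Tendsto gcdf atBot (𝓝 0) := by
  rw [funext gcdf_eq_cdf]; exact tendsto_cdf_atBot _

lemma tendsto_gcdf_atTop : Tendsto gcdf atTop (𝓝 1) := by
  rw [funext gcdf_eq_cdf]; exact tendsto_cdf_atTop _

lemma gcdf_mem_Ioo (s : ℝ) : gcdf s ∈ Set.Ioo (0 : ℝ) 1 := by
  constructor
  · refine lt_of_le_of_lt ?_ (strictMono_gcdf (sub_one_lt s))
    rw [gcdf_eq_cdf]; exact cdf_nonneg _ _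
  · refine lt_of_lt_of_le (strictMono_gcdf (lt_add_one s)) ?_
    rw [gcdf_eq_cdf]; exact cdf_le_one _ _

lemma exists_gcdf_eq {p : ℝ} (hp : p ∈ Set.Ioo (0 : ℝ) 1) : ∃ s, gcdf s = p := by
  obtain ⟨s₁, h₁⟩ := (tendsto_gcdf_atBot.eventually (gt_mem_nhds hp.1)).exists
  obtain ⟨s₂, h₂⟩ := (tendsto_gcdf_atTop.eventually (lt_mem_nhds hp.2)).exists
  exact mem_range_of_exists_le_of_exists_ge continuous_gcdf ⟨s₁, h₁.le⟩ ⟨s₂, h₂.le⟩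

/-- The standard Gaussian quantile function, inverse to `gcdf` on `(0, 1)`. -/
def gquant : ℝ → ℝ := Function.invFun gcdf

lemma gcdf_gquant {p : ℝ} (hp : p ∈ Set.Ioo (0 : ℝ) 1) : gcdf (gquant p) = p :=
  Function.invFun_eq (exists_gcdf_eq hp)

@[simp] lemma gquant_gcdf (s : ℝ) : gquant (gcdf s) = s :=
  Function.leftInverse_invFun strictMono_gcdf.injective s

lemma gquant_le_iff {p : ℝ} (hp : p ∈ Set.Ioo (0 : ℝ) 1) {s : ℝ} : gquant p ≤ s ↔ p ≤ gcdf s := by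
  rw [← strictMono_gcdf.le_iff_le, gcdf_gquant hp]

lemma le_gquant_iff {p : ℝ} (hp : p ∈ Set.Ioo (0 : ℝ) 1) {s : ℝ} : s ≤ gquant p ↔ gcdf s ≤ p := by
  rw [← strictMono_gcdf.le_iff_le, gcdf_gquant hp]

lemma gquant_mono {p q : ℝ} (hp : p ∈ Set.Ioo (0 : ℝ) 1) (hq : q ∈ Set.Ioo (0 : ℝ) 1)
    (h : p ≤ q) : gquant p ≤ gquant q := by
  rwa [gquant_le_iff hp, gcdf_gquant hq]

lemma continuousAt_gquant {p : ℝ} (hp : p ∈ Set.Ioo (0 : ℝ) 1) : ContinuousAt gquant p := by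
  apply StrictMonoOn.continuousAt_of_image_mem_nhds (s := Set.Ioo 0 1) _ (Ioo_mem_nhds hp.1 hp.2)
  · convert univ_mem
    refine Set.eq_univ_of_forall fun s => ⟨gcdf s, gcdf_mem_Ioo s, gquant_gcdf s⟩
  · intro x hx y hy hxy
    rwa [← strictMono_gcdf.lt_iff_lt, gcdf_gquant hx, gcdf_gquant hy]

lemma hasDerivAt_gquant {p : ℝ} (hp : p ∈ Set.Ioo (0 : ℝ) 1) :
    HasDerivAt gquant (gpdf (gquant p))⁻¹ p :=
  (hasDerivAt_gcdf _).of_local_left_inverse (continuousAt_gquant hp) (gpdf_pos _).ne'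
    (Filter.mem_of_superset (Ioo_mem_nhds hp.1 hp.2) fun _ h => gcdf_gquant h)

lemma measurable_gquant : Measurable gquant := by
  have h : ∀ p ∉ Set.Ioo (0 : ℝ) 1, gquant p = gquant 0 := by
    intro p hp
    have h0 : ∀ q ∉ Set.Ioo (0 : ℝ) 1, gquant q = Classical.arbitrary ℝ := fun q hq =>
      Function.invFun_neg fun ⟨s, hs⟩ => hq (hs ▸ gcdf_mem_Ioo s)
    rw [h0 p hp, h0 0 (by simp)]
  refine measurable_of_restrict_of_restrict_compl (measurableSet_Ioo (a := (0 : ℝ)) (b := 1)) ?_ ?_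
  · exact (continuousOn_iff_continuous_domRestrict.1 fun p hp =>
      (continuousAt_gquant hp).continuousWithinAt).measurable
  · convert (measurable_const (a := gquant 0))
    rename_i p
    exact h _ p.2

lemma tendsto_gquant_one : Tendsto gquant (𝓝[<] 1) atTop := by
  rw [tendsto_atTop]
  intro s
  filter_upwards [Ioo_mem_nhdsLT (gcdf_mem_Ioo s).2] with p hp
  exact (le_gquant_iff ⟨(gcdf_mem_Ioo s).1.trans hp.1, hp.2⟩).2 hp.1.le

lemma tendsto_gquant_zero : Tendsto gquant (𝓝[>] 0) atBot := by
  rw [tendsto_atBot]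
  intro s
  filter_upwards [Ioo_mem_nhdsGT (gcdf_mem_Ioo s).1] with p hp
  exact (gquant_le_iff ⟨hp.1, hp.2.trans (gcdf_mem_Ioo s).2⟩).2 hp.2.le

lemma abs_gcdf_taylor_two_le (w d : ℝ) : |gcdf (w + d) - gcdf w - gpdf w * d| ≤ |d| ^ 2 := by
  simpa using abs_taylor_two_le hasDerivAt_gcdf hasDerivAt_gpdf abs_mul_gpdf_le w d

lemma abs_gcdf_taylor_three_le (w d : ℝ) :
    |gcdf (w + d) - gcdf w - gpdf w * d + w * gpdf w * d ^ 2 / 2| ≤ |d| ^ 3 := by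
  have := abs_taylor_three_le hasDerivAt_gcdf hasDerivAt_gpdf hasDerivAt_neg_mul_gpdf
    abs_sq_sub_one_mul_gpdf_le w d
  rw [one_mul] at this
  convert this using 2
  ring

/-- `F₁, F₂, F₃` are the first three derivatives of `F`, and all are bounded by `M`. -/
structure BoundedJet (M : ℝ) (F F₁ F₂ F₃ : ℝ → ℝ) : Prop where
  d₁ : ∀ x, HasDerivAt F (F₁ x) x
  d₂ : ∀ x, HasDerivAt F₁ (F₂ x) x
  d₃ : ∀ x, HasDerivAt F₂ (F₃ x) x
  b₁ : ∀ x, |F₁ x| ≤ M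
  b₂ : ∀ x, |F₂ x| ≤ M
  b₃ : ∀ x, |F₃ x| ≤ M

lemma BoundedJet.mono {M M' : ℝ} {F F₁ F₂ F₃ : ℝ → ℝ} (h : BoundedJet M F F₁ F₂ F₃)
    (hM : M ≤ M') : BoundedJet M' F F₁ F₂ F₃ :=
  ⟨h.d₁, h.d₂, h.d₃, fun x => (h.b₁ x).trans hM, fun x => (h.b₂ x).trans hM,
    fun x => (h.b₃ x).trans hM⟩

lemma mem_Ioo_of_mem_Icc {ε p : ℝ} (hε : 0 < ε) (hp : p ∈ Set.Icc ε (1 - ε)) :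
    p ∈ Set.Ioo (0 : ℝ) 1 := ⟨hε.trans_le hp.1, by linarith [hp.2]⟩

lemma exists_gquant_bound {ε : ℝ} (hε : 0 < ε) :
    ∃ L, 1 ≤ L ∧ ∀ p ∈ Set.Icc ε (1 - ε), |gquant p| ≤ L ∧ (gpdf (gquant p))⁻¹ ≤ L := by
  by_cases h : ε ≤ 1 - ε
  · have h1 : ε ∈ Set.Icc ε (1 - ε) := ⟨le_rfl, h⟩
    have h2 : 1 - ε ∈ Set.Icc ε (1 - ε) := ⟨h, le_rfl⟩
    have hc : ContinuousOn gquant (Set.Icc ε (1 - ε)) := fun p hp =>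
      (continuousAt_gquant (mem_Ioo_of_mem_Icc hε hp)).continuousWithinAt
    have hc' : ContinuousOn (fun p => (gpdf (gquant p))⁻¹) (Set.Icc ε (1 - ε)) :=
      (continuous_gpdf.comp_continuousOn hc).inv₀ fun p _ => (gpdf_pos _).ne'
    obtain ⟨C, hC⟩ := isCompact_Icc.exists_bound_of_continuousOn hc
    obtain ⟨C', hC'⟩ := isCompact_Icc.exists_bound_of_continuousOn hc'
    exact ⟨max 1 (max C C'), le_max_left _ _, fun p hp =>
      ⟨(hC p hp).trans (by simp), (le_abs_self _).trans ((hC' p hp).trans (by simp))⟩⟩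
  · exact ⟨1, le_rfl, fun p hp => absurd (hp.1.trans hp.2) h⟩

lemma abs_gquant_sub_le {ε L : ℝ} (hε : 0 < ε)
    (hL : ∀ p ∈ Set.Icc ε (1 - ε), |gquant p| ≤ L ∧ (gpdf (gquant p))⁻¹ ≤ L)
    {p q : ℝ} (hp : p ∈ Set.Icc ε (1 - ε)) (hq : q ∈ Set.Icc ε (1 - ε)) :
    |gquant q - gquant p - (q - p) * (gpdf (gquant p))⁻¹| ≤ L ^ 3 * |q - p| ^ 2 := by
  have hlip : |gquant q - gquant p| ≤ L * |q - p| := by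
    have := Convex.norm_image_sub_le_of_norm_hasDerivWithin_le (f := gquant)
      (f' := fun p => (gpdf (gquant p))⁻¹) (C := L) (s := Set.Icc ε (1 - ε)) (x := p) (y := q)
      (fun y hy => (hasDerivAt_gquant (mem_Ioo_of_mem_Icc hε hy)).hasDerivWithinAt)
      (fun y hy => by
        rw [norm_of_nonneg (inv_nonneg.2 (gpdf_pos _).le)]; exact (hL y hy).2)
      (convex_Icc _ _) hp hq
    exact this
  have ht := abs_gcdf_taylor_two_le (gquant p) (gquant q - gquant p)
  rw [add_sub_cancel, gcdf_gquant (mem_Ioo_of_mem_Icc hε hp),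
    gcdf_gquant (mem_Ioo_of_mem_Icc hε hq)] at ht
  have hg := gpdf_pos (gquant p)
  have h0 : 0 ≤ L := (abs_nonneg _).trans (hL p hp).1
  calc _ = |q - p - gpdf (gquant p) * (gquant q - gquant p)| * (gpdf (gquant p))⁻¹ := by
        rw [← abs_of_pos (inv_pos.2 hg), ← abs_mul, abs_sub_comm, abs_of_pos (inv_pos.2 hg)]
        congr 1
        field_simp
    _ ≤ |gquant q - gquant p| ^ 2 * L := by
        gcongr
        exact (hL p hp).2
    _ ≤ (L * |q - p|) ^ 2 * L := by gcongr
    _ = _ := by ring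

lemma exists_boundedJet_gquant_comp {ε M : ℝ} (hε : 0 < ε) (hM : 0 ≤ M) :
    ∃ K, 1 ≤ K ∧ ∀ f f₁ f₂ f₃ : ℝ → ℝ, BoundedJet M f f₁ f₂ f₃ →
      (∀ x, f x ∈ Set.Icc ε (1 - ε)) → ∃ U₁ U₂ U₃ : ℝ → ℝ,
      BoundedJet K (fun x => gquant (f x)) U₁ U₂ U₃ ∧
      (∀ x, f₂ x * (gpdf (gquant (f x)))⁻¹ = U₂ x - gquant (f x) * U₁ x ^ 2) ∧
      (∀ x, |gquant (f x)| ≤ K) := by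
  obtain ⟨L, hL1, hL⟩ := exists_gquant_bound hε
  have hL0 : 0 ≤ L := zero_le_one.trans hL1
  set K₁ := M * L with hK₁
  set K₂ := M * L + L * K₁ ^ 2 with hK₂
  set K₃ := M * L + M * (L * K₁ * L) + (K₁ * K₁ ^ 2 + L * (2 * K₁ * K₂)) with hK₃
  have p1 : 0 ≤ K₁ := by positivity
  have p2 : 0 ≤ K₂ := by positivity
  have p3 : 0 ≤ K₃ := by positivity
  refine ⟨L + K₁ + K₂ + K₃, by linarith, fun f f₁ f₂ f₃ hf hmem => ?_⟩
  set U : ℝ → ℝ := fun x => gquant (f x) with hU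
  set w : ℝ → ℝ := fun x => (gpdf (U x))⁻¹ with hw
  have hwp : ∀ x, 0 < w x := fun x => inv_pos.2 (gpdf_pos _)
  have hwL : ∀ x, |w x| ≤ L := fun x => by rw [abs_of_pos (hwp x)]; exact (hL _ (hmem x)).2
  have hUL : ∀ x, |U x| ≤ L := fun x => (hL _ (hmem x)).1
  set U₁ : ℝ → ℝ := fun x => f₁ x * w x with hU₁
  set U₂ : ℝ → ℝ := fun x => f₂ x * w x + U x * U₁ x ^ 2 with hU₂
  set U₃ : ℝ → ℝ := fun x => f₃ x * w x + f₂ x * (U x * U₁ x * w x) +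
    (U₁ x * U₁ x ^ 2 + U x * (2 * U₁ x * U₂ x)) with hU₃
  have dU : ∀ x, HasDerivAt U (U₁ x) x := fun x =>
    ((hasDerivAt_gquant (mem_Ioo_of_mem_Icc hε (hmem x))).comp x (hf.d₁ x)).congr_deriv
      (by simp only [hU₁, hw]; ring)
  have dw : ∀ x, HasDerivAt w (U x * U₁ x * w x) x := fun x => by
    refine (((hasDerivAt_gpdf (U x)).comp x (dU x)).fun_inv (gpdf_pos _).ne').congr_deriv ?_
    have := (gpdf_pos (U x)).ne'
    simp only [Function.comp, hw]
    field_simp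
  have dU₁ : ∀ x, HasDerivAt U₁ (U₂ x) x := fun x =>
    ((hf.d₂ x).fun_mul (dw x)).congr_deriv (by simp only [hU₂, hU₁]; ring)
  have dU₂ : ∀ x, HasDerivAt U₂ (U₃ x) x := fun x =>
    (((hf.d₃ x).fun_mul (dw x)).fun_add ((dU x).fun_mul ((dU₁ x).fun_pow 2))).congr_deriv
      (by simp only [hU₃]; push_cast; ring)
  have bU₁ : ∀ x, |U₁ x| ≤ K₁ := fun x => by
    rw [hU₁, abs_mul]; exact mul_le_mul (hf.b₁ x) (hwL x) (abs_nonneg _) hM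
  have bU₂ : ∀ x, |U₂ x| ≤ K₂ := fun x => by
    have := hf.b₂ x; have := hwL x; have := hUL x; have := bU₁ x
    refine (abs_add_le _ _).trans (add_le_add ?_ ?_) <;>
    · simp only [abs_mul, abs_pow]
      gcongr
  have bU₃ : ∀ x, |U₃ x| ≤ K₃ := fun x => by
    have := hf.b₂ x; have := hf.b₃ x; have := hwL x; have := hUL x; have := bU₁ x; have := bU₂ x
    refine (abs_add_le _ _).trans (add_le_add ((abs_add_le _ _).trans (add_le_add ?_ ?_))
      ((abs_add_le _ _).trans (add_le_add ?_ ?_))) <;>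
    · simp only [abs_mul, abs_pow, abs_two]
      gcongr
  refine ⟨U₁, U₂, U₃, ⟨dU, dU₁, dU₂, fun x => (bU₁ x).trans ?_, fun x => (bU₂ x).trans ?_,
    fun x => (bU₃ x).trans ?_⟩, fun x => ?_, fun x => (hUL x).trans ?_⟩
  all_goals linarith

lemma abs_jet_shift_sub_le {K r ξ m N : ℝ} {U U₁ U₂ U₃ : ℝ → ℝ} (hK : 1 ≤ K)
    (hU : BoundedJet K U U₁ U₂ U₃) (hr0 : 0 ≤ r) (hr1 : r ≤ 1) (hN : 1 ≤ N) (hξ : |ξ| ≤ N)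
    (hm : |m| ≤ K) (x : ℝ) :
    |U (x + (r * ξ + r ^ 2 * m)) - U x| ≤ 2 * K ^ 2 * (r * N) ∧
    |U (x + (r * ξ + r ^ 2 * m)) - U x - r * (U₁ x * ξ) - r ^ 2 * (U₁ x * m + U₂ x * ξ ^ 2 / 2)|
      ≤ 10 * K ^ 4 * (r ^ 3 * N ^ 3) := by
  set d := r * ξ + r ^ 2 * m with hd
  have hK0 : 0 ≤ K := zero_le_one.trans hK
  have hN0 : 0 ≤ N := zero_le_one.trans hN
  have hKN : K ≤ K * N := le_mul_of_one_le_right hK0 hN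
  have hNK : N ≤ K * N := le_mul_of_one_le_left hN0 hK
  have hr2 : r ^ 2 ≤ r := by nlinarith
  have hd' : |d| ≤ 2 * K * (r * N) := by
    calc |d| ≤ |r * ξ| + |r ^ 2 * m| := abs_add_le _ _
      _ = r * |ξ| + r ^ 2 * |m| := by
          rw [abs_mul, abs_mul, abs_of_nonneg hr0, abs_of_nonneg (sq_nonneg r)]
      _ ≤ r * (K * N) + r * (K * N) := by
          gcongr
          · exact hξ.trans hNK
          · exact hm.trans hKN
      _ = _ := by ring
  constructor
  · calc _ ≤ K * |d| := abs_taylor_one_le hU.d₁ hU.b₁ x d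
      _ ≤ K * (2 * K * (r * N)) := by gcongr
      _ = _ := by ring
  · have ht := abs_taylor_three_le hU.d₁ hU.d₂ hU.d₃ hU.b₃ x d
    have he : |U₂ x * (r ^ 3 * ξ * m + r ^ 4 * m ^ 2 / 2)| ≤ 2 * K ^ 4 * (r ^ 3 * N ^ 3) := by
      have hr4 : r ^ 4 ≤ r ^ 3 := pow_le_pow_of_le_one hr0 hr1 (by norm_num)
      have hN3 : N ≤ N ^ 3 := le_self_pow₀ hN (by norm_num)
      have hN31 : 1 ≤ N ^ 3 := one_le_pow₀ hN
      have hK34 : K ^ 3 ≤ K ^ 4 := pow_le_pow_right₀ hK (by norm_num)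
      have hK24 : K ^ 2 ≤ K ^ 4 := pow_le_pow_right₀ hK (by norm_num)
      rw [abs_mul]
      calc _ ≤ K * (|r ^ 3 * ξ * m| + |r ^ 4 * m ^ 2 / 2|) := by
            gcongr
            · exact hU.b₂ x
            · exact abs_add_le _ _
        _ = K * (r ^ 3 * |ξ| * |m| + r ^ 4 * |m| ^ 2 / 2) := by
            simp only [abs_mul, abs_div, abs_pow, abs_two, abs_of_nonneg hr0]
        _ ≤ K * (r ^ 3 * N ^ 3 * K + r ^ 3 * K ^ 2 / 2) := by
            gcongr
            exact hξ.trans hN3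
        _ = K ^ 2 * (r ^ 3 * N ^ 3) + K ^ 3 * (r ^ 3 * 1) / 2 := by ring
        _ ≤ K ^ 4 * (r ^ 3 * N ^ 3) + K ^ 4 * (r ^ 3 * N ^ 3) / 2 := by gcongr
        _ ≤ _ := by
            have : 0 ≤ K ^ 4 * (r ^ 3 * N ^ 3) := by positivity
            linarith
    calc _ = |(U (x + d) - U x - U₁ x * d - U₂ x * d ^ 2 / 2) +
          U₂ x * (r ^ 3 * ξ * m + r ^ 4 * m ^ 2 / 2)| := by
            congr 1; rw [hd]; ring
      _ ≤ K * |d| ^ 3 + 2 * K ^ 4 * (r ^ 3 * N ^ 3) := (abs_add_le _ _).trans (add_le_add ht he)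
      _ ≤ K * (2 * K * (r * N)) ^ 3 + 2 * K ^ 4 * (r ^ 3 * N ^ 3) := by gcongr
      _ = _ := by ring

lemma gcdf_jet_shift_lower {a b K r ξ η m l N : ℝ} {U U₁ U₂ U₃ V V₁ V₂ V₃ : ℝ → ℝ}
    (ha : 0 < a) (hb : 0 < b) (hK : 1 ≤ K)
    (hU : BoundedJet K U U₁ U₂ U₃) (hV : BoundedJet K V V₁ V₂ V₃)
    (hr0 : 0 ≤ r) (hr1 : r ≤ 1) (hN : 1 ≤ N) (hξ : |ξ| ≤ N) (hη : |η| ≤ N)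
    (hm : |m| ≤ K) (hl : |l| ≤ K) (x y : ℝ) :
    gcdf (a * U x + b * V y) + gpdf (a * U x + b * V y) *
        (r * (a * (U₁ x * ξ) + b * (V₁ y * η)) +
          r ^ 2 * (a * (U₁ x * m + U₂ x * ξ ^ 2 / 2) + b * (V₁ y * l + V₂ y * η ^ 2 / 2)))
      - (a * U x + b * V y) * gpdf (a * U x + b * V y) *
        (r ^ 2 * (a * (U₁ x * ξ) + b * (V₁ y * η)) ^ 2) / 2
      - (10 * (a + b) * K ^ 4 + 18 * (a + b) ^ 2 * K ^ 6 + 8 * (a + b) ^ 3 * K ^ 6) *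
        (r ^ 3 * N ^ 4)
      ≤ gcdf (a * U (x + (r * ξ + r ^ 2 * m)) + b * V (y + (r * η + r ^ 2 * l))) := by
  have hK0 : 0 ≤ K := zero_le_one.trans hK
  have hN0 : 0 ≤ N := zero_le_one.trans hN
  obtain ⟨u1, u2⟩ := abs_jet_shift_sub_le hK hU hr0 hr1 hN hξ hm x
  obtain ⟨v1, v2⟩ := abs_jet_shift_sub_le hK hV hr0 hr1 hN hη hl y
  have pU₁ := hU.b₁ x
  have pU₂ := hU.b₂ x
  have pV₁ := hV.b₁ y
  have pV₂ := hV.b₂ y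
  set w := a * U x + b * V y with hw
  set D := a * (U (x + (r * ξ + r ^ 2 * m)) - U x) + b * (V (y + (r * η + r ^ 2 * l)) - V y) with hD
  set A := a * (U₁ x * ξ) + b * (V₁ y * η) with hA
  set B := a * (U₁ x * m + U₂ x * ξ ^ 2 / 2) + b * (V₁ y * l + V₂ y * η ^ 2 / 2) with hB
  set c := a + b with hc
  have hc0 : 0 < c := add_pos ha hb
  have hsum : a * U (x + (r * ξ + r ^ 2 * m)) + b * V (y + (r * η + r ^ 2 * l)) = w + D := by
    rw [hw, hD]; ring
  have lin : ∀ {p q P : ℝ}, |p| ≤ P → |q| ≤ P → |a * p + b * q| ≤ c * P := by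
    intro p q P hp hq
    calc _ ≤ |a * p| + |b * q| := abs_add_le _ _
      _ = a * |p| + b * |q| := by rw [abs_mul, abs_mul, abs_of_pos ha, abs_of_pos hb]
      _ ≤ a * P + b * P := by gcongr
      _ = _ := by rw [hc]; ring
  have hD1 : |D| ≤ c * (2 * K ^ 2 * (r * N)) := lin u1 v1
  have hD3 : |D - r * A - r ^ 2 * B| ≤ c * (10 * K ^ 4 * (r ^ 3 * N ^ 3)) := by
    convert lin u2 v2 using 2
    rw [hD, hA, hB]; ring
  have hA1 : |A| ≤ c * (K * N) :=
    lin (by rw [abs_mul]; gcongr) (by rw [abs_mul]; gcongr)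
  have hB1 : |B| ≤ c * (2 * K ^ 2 * N ^ 2) := by
    have key : ∀ {u₁ u₂ m ξ : ℝ}, |u₁| ≤ K → |u₂| ≤ K → |m| ≤ K → |ξ| ≤ N →
        |u₁ * m + u₂ * ξ ^ 2 / 2| ≤ 2 * K ^ 2 * N ^ 2 := by
      intro u₁ u₂ m ξ h1 h2 h3 h4
      calc _ ≤ |u₁| * |m| + |u₂| * |ξ| ^ 2 / 2 := by
            refine (abs_add_le _ _).trans ?_
            simp only [abs_mul, abs_div, abs_pow, abs_two, le_refl]
        _ ≤ K * K + K * N ^ 2 / 2 := by gcongr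
        _ = K ^ 2 * 1 + K * 1 * N ^ 2 / 2 := by ring
        _ ≤ K ^ 2 * N ^ 2 + K * K * N ^ 2 / 2 := by
            gcongr
            exact one_le_pow₀ hN
        _ ≤ _ := by nlinarith [mul_nonneg (sq_nonneg K) (sq_nonneg N)]
    exact lin (key pU₁ pU₂ hm hξ) (key pV₁ pV₂ hl hη)
  have hDA : |D - r * A| ≤ 12 * c * K ^ 4 * (r ^ 2 * N ^ 3) := by
    calc _ = |(D - r * A - r ^ 2 * B) + r ^ 2 * B| := by congr 1; ring
      _ ≤ c * (10 * K ^ 4 * (r ^ 3 * N ^ 3)) + r ^ 2 * (c * (2 * K ^ 2 * N ^ 2)) := by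
          refine (abs_add_le _ _).trans (add_le_add hD3 ?_)
          rw [abs_mul, abs_of_nonneg (sq_nonneg r)]
          gcongr
      _ ≤ c * (10 * K ^ 4 * (r ^ 2 * N ^ 3)) + r ^ 2 * (c * (2 * K ^ 4 * N ^ 3)) := by
          have h1 : r ^ 3 ≤ r ^ 2 := pow_le_pow_of_le_one hr0 hr1 (by norm_num)
          have h2 : K ^ 2 ≤ K ^ 4 := pow_le_pow_right₀ hK (by norm_num)
          have h3 : N ^ 2 ≤ N ^ 3 := pow_le_pow_right₀ hN (by norm_num)
          gcongr
      _ = _ := by ring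
  have hDA' : |D + r * A| ≤ 3 * c * K ^ 2 * (r * N) := by
    calc _ ≤ c * (2 * K ^ 2 * (r * N)) + r * (c * (K * N)) := by
          refine (abs_add_le _ _).trans (add_le_add hD1 ?_)
          rw [abs_mul, abs_of_nonneg hr0]
          gcongr
      _ ≤ c * (2 * K ^ 2 * (r * N)) + r * (c * (K ^ 2 * N)) := by
          have h2 : K ≤ K ^ 2 := le_self_pow₀ hK (by norm_num)
          gcongr
      _ = _ := by ring
  have hsq : |D ^ 2 - r ^ 2 * A ^ 2| ≤ 36 * c ^ 2 * K ^ 6 * (r ^ 3 * N ^ 4) := by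
    calc _ = |D - r * A| * |D + r * A| := by rw [← abs_mul]; congr 1; ring
      _ ≤ (12 * c * K ^ 4 * (r ^ 2 * N ^ 3)) * (3 * c * K ^ 2 * (r * N)) := by gcongr
      _ = _ := by ring
  have hN34 : N ^ 3 ≤ N ^ 4 := pow_le_pow_right₀ hN (by norm_num)
  have hcube : |D| ^ 3 ≤ 8 * c ^ 3 * K ^ 6 * (r ^ 3 * N ^ 4) := by
    calc _ ≤ (c * (2 * K ^ 2 * (r * N))) ^ 3 := by gcongr
      _ = 8 * c ^ 3 * K ^ 6 * (r ^ 3 * N ^ 3) := by ring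
      _ ≤ _ := by gcongr
  have hg := abs_gpdf_le_one w
  have hwg := abs_mul_gpdf_le w
  rw [abs_neg] at hwg
  have t1 : |gpdf w * (D - r * A - r ^ 2 * B)| ≤ 10 * c * K ^ 4 * (r ^ 3 * N ^ 4) := by
    rw [abs_mul]
    calc _ ≤ 1 * (c * (10 * K ^ 4 * (r ^ 3 * N ^ 3))) :=
          mul_le_mul hg hD3 (abs_nonneg _) zero_le_one
      _ ≤ 1 * (c * (10 * K ^ 4 * (r ^ 3 * N ^ 4))) := by gcongr
      _ = _ := by ring
  have t2 : |w * gpdf w * (D ^ 2 - r ^ 2 * A ^ 2)| ≤ 36 * c ^ 2 * K ^ 6 * (r ^ 3 * N ^ 4) := by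
    rw [abs_mul]
    exact (mul_le_mul hwg hsq (abs_nonneg _) zero_le_one).trans_eq (one_mul _)
  have ht := (abs_le.1 (abs_gcdf_taylor_three_le w D)).1
  rw [hsum]
  have t1' := (abs_le.1 t1).1
  have t2' := (abs_le.1 t2).2
  linarith

/-- The standard Gaussian measure on the line. -/
abbrev gauss : Measure ℝ := gaussianReal 0 1

lemma integrable_one_add_abs_pow_four : Integrable (fun t : ℝ => (1 + |t|) ^ 4) gauss := by
  have h₀ : MemLp (fun t : ℝ => ‖t‖) ((4 : ℕ) : ENNReal) gauss :=
    (memLp_id_gaussianReal' ((4 : ℕ) : ENNReal) (ENNReal.natCast_ne_top 4)).norm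
  have h₁ : MemLp (fun _ : ℝ => (1 : ℝ)) ((4 : ℕ) : ENNReal) gauss := memLp_const 1
  have := (h₁.add h₀).integrable_norm_pow (p := 4) (by simp)
  refine this.congr (ae_of_all _ fun t => ?_)
  simp only [norm_eq_abs, Pi.add_apply]
  rw [abs_of_nonneg (by positivity : (0 : ℝ) ≤ 1 + |t|)]

lemma integrable_id_gauss : Integrable (fun t : ℝ => t) gauss :=
  (memLp_id_gaussianReal' 1 (by simp)).integrable le_rfl

lemma integrable_sq_gauss : Integrable (fun t : ℝ => t ^ 2) gauss :=
  (memLp_id_gaussianReal' 2 (by simp)).integrable_sq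

lemma integral_id_gauss : ∫ t, t ∂gauss = 0 := integral_id_gaussianReal

lemma integral_sq_gauss : ∫ t, t ^ 2 ∂gauss = 1 := by
  have := variance_fun_id_gaussianReal (μ := 0) (v := 1)
  rw [variance_of_integral_eq_zero (by fun_prop) integral_id_gaussianReal] at this
  simpa using this

lemma integral_gauss_prod_quadratic (c₀ c₁ c₂ c₃ c₄ c₅ : ℝ) :
    Integrable (fun p : ℝ × ℝ => c₀ + c₁ * p.1 + c₂ * p.2 + c₃ * p.1 ^ 2 + c₄ * (p.1 * p.2) +
      c₅ * p.2 ^ 2) (gauss.prod gauss) ∧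
    ∫ p : ℝ × ℝ, (c₀ + c₁ * p.1 + c₂ * p.2 + c₃ * p.1 ^ 2 + c₄ * (p.1 * p.2) +
      c₅ * p.2 ^ 2) ∂(gauss.prod gauss) = c₀ + c₃ + c₅ := by
  have i1 : Integrable (fun p : ℝ × ℝ => p.1) (gauss.prod gauss) := integrable_id_gauss.comp_fst _
  have i2 : Integrable (fun p : ℝ × ℝ => p.2) (gauss.prod gauss) := integrable_id_gauss.comp_snd _
  have i3 : Integrable (fun p : ℝ × ℝ => p.1 ^ 2) (gauss.prod gauss) :=
    integrable_sq_gauss.comp_fst _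
  have i4 : Integrable (fun p : ℝ × ℝ => p.1 * p.2) (gauss.prod gauss) :=
    integrable_id_gauss.mul_prod integrable_id_gauss
  have i5 : Integrable (fun p : ℝ × ℝ => p.2 ^ 2) (gauss.prod gauss) :=
    integrable_sq_gauss.comp_snd _
  have i0 : Integrable (fun _ : ℝ × ℝ => c₀) (gauss.prod gauss) := integrable_const _
  have e1 : ∫ p : ℝ × ℝ, p.1 ∂(gauss.prod gauss) = 0 := by
    rw [integral_fun_fst (fun t => t), integral_id_gauss]; simp
  have e2 : ∫ p : ℝ × ℝ, p.2 ∂(gauss.prod gauss) = 0 := by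
    rw [integral_fun_snd (fun t => t), integral_id_gauss]; simp
  have e3 : ∫ p : ℝ × ℝ, p.1 ^ 2 ∂(gauss.prod gauss) = 1 := by
    rw [integral_fun_fst (fun t => t ^ 2), integral_sq_gauss]; simp
  have e4 : ∫ p : ℝ × ℝ, p.1 * p.2 ∂(gauss.prod gauss) = 0 := by
    rw [integral_prod_mul (fun t => t) (fun t => t), integral_id_gauss]; simp
  have e5 : ∫ p : ℝ × ℝ, p.2 ^ 2 ∂(gauss.prod gauss) = 1 := by
    rw [integral_fun_snd (fun t => t ^ 2), integral_sq_gauss]; simp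
  have j1 := i0.fun_add (i1.const_mul c₁)
  have j2 := j1.fun_add (i2.const_mul c₂)
  have j3 := j2.fun_add (i3.const_mul c₃)
  have j4 := j3.fun_add (i4.const_mul c₄)
  have j5 := j4.fun_add (i5.const_mul c₅)
  refine ⟨j5, ?_⟩
  rw [integral_add j4 (i5.const_mul c₅), integral_add j3 (i4.const_mul c₄),
    integral_add j2 (i3.const_mul c₃), integral_add j1 (i2.const_mul c₂),
    integral_add i0 (i1.const_mul c₁)]
  simp only [integral_const_mul, e1, e2, e3, e4, e5]
  simp

lemma map_gauss_prod_linear (α β : ℝ) :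
    (gauss.prod gauss).map (fun p => α * p.1 + β * p.2) =
      gauss.map (fun t => √(α ^ 2 + β ^ 2) * t) := by
  have h1 : (gauss.prod gauss).map (fun p => α * p.1) =
      gaussianReal 0 (NNReal.mk (α ^ 2) (sq_nonneg α)) := by
    have := gaussianReal_map_const_mul (μ := 0) (v := 1) α
    rw [show (fun p : ℝ × ℝ => α * p.1) = (fun t => α * t) ∘ Prod.fst from rfl,
      ← Measure.map_map (by fun_prop) (by fun_prop), Measure.map_fst_prod]
    simpa using this
  have h2 : (gauss.prod gauss).map (fun p => β * p.2) =
      gaussianReal 0 (NNReal.mk (β ^ 2) (sq_nonneg β)) := by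
    have := gaussianReal_map_const_mul (μ := 0) (v := 1) β
    rw [show (fun p : ℝ × ℝ => β * p.2) = (fun t => β * t) ∘ Prod.snd from rfl,
      ← Measure.map_map (by fun_prop) (by fun_prop), Measure.map_snd_prod]
    simpa using this
  have hind : IndepFun (fun p : ℝ × ℝ => α * p.1) (fun p => β * p.2) (gauss.prod gauss) :=
    indepFun_prod (X := fun t => α * t) (Y := fun t => β * t) (by fun_prop) (by fun_prop)
  have h3 := gaussianReal_add_gaussianReal_of_indepFun hind h1 h2
  rw [show (fun p : ℝ × ℝ => α * p.1 + β * p.2) = (fun p => α * p.1) + fun p => β * p.2 from rfl,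
    h3, gaussianReal_map_const_mul]
  congr 1
  · simp
  · ext; simp [Real.sq_sqrt (add_nonneg (sq_nonneg α) (sq_nonneg β))]

lemma integral_gauss_prod_linear (h : ℝ → ℝ) (hh : Measurable h) (z α β : ℝ) :
    ∫ p : ℝ × ℝ, h (z + (α * p.1 + β * p.2)) ∂(gauss.prod gauss) =
      ∫ t, h (z + √(α ^ 2 + β ^ 2) * t) ∂gauss := by
  have hm : Measurable fun s => h (z + s) := by fun_prop
  rw [← integral_map (φ := fun p : ℝ × ℝ => α * p.1 + β * p.2) (f := fun s => h (z + s))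
    (by fun_prop) hm.aestronglyMeasurable, map_gauss_prod_linear,
    integral_map (by fun_prop) hm.aestronglyMeasurable]

/-- Averaging of `f` against the centred Gaussian law of standard deviation `r`. -/
def gavg (r : ℝ) (f : ℝ → ℝ) (x : ℝ) : ℝ := ∫ t, f (x + r * t) ∂gauss

lemma integrable_of_measurable_of_bound {Ω : Type*} [MeasurableSpace Ω] {μ : Measure Ω}
    [IsFiniteMeasure μ] {f : Ω → ℝ} {C : ℝ} (hf : Measurable f) (hC : ∀ x, |f x| ≤ C) :
    Integrable f μ :=
  Integrable.of_bound hf.aestronglyMeasurable C (ae_of_all _ hC)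

lemma measurable_gavg {r : ℝ} {f : ℝ → ℝ} (hf : Measurable f) : Measurable (gavg r f) := by
  have : StronglyMeasurable fun p : ℝ × ℝ => f (p.1 + r * p.2) :=
    (by fun_prop : Measurable _).stronglyMeasurable
  exact this.integral_prod_right'.measurable

lemma integral_mem_Icc_of_mem_Icc {Ω : Type*} [MeasurableSpace Ω] {μ : Measure Ω}
    [IsProbabilityMeasure μ] {f : Ω → ℝ} {c d : ℝ} (hf : Measurable f)
    (h : ∀ x, f x ∈ Set.Icc c d) : ∫ x, f x ∂μ ∈ Set.Icc c d := by
  have hi : Integrable f μ := integrable_of_measurable_of_bound (C := max |c| |d|) hf fun x =>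
    abs_le_max_abs_abs (h x).1 (h x).2
  constructor
  · simpa using integral_mono (integrable_const c) hi fun x => (h x).1
  · simpa using integral_mono hi (integrable_const d) fun x => (h x).2

lemma gavg_mem_Icc {r c d : ℝ} {f : ℝ → ℝ} (hf : Measurable f) (h : ∀ x, f x ∈ Set.Icc c d)
    (x : ℝ) : gavg r f x ∈ Set.Icc c d :=
  integral_mem_Icc_of_mem_Icc (by fun_prop) fun t => h (x + r * t)

lemma abs_gavg_le {r C : ℝ} {f : ℝ → ℝ} (hf : Measurable f) (h : ∀ x, |f x| ≤ C) (x : ℝ) :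
    |gavg r f x| ≤ C := abs_le.2 (gavg_mem_Icc hf (fun x => abs_le.1 (h x)) x)

lemma gavg_gavg {r s : ℝ} {f : ℝ → ℝ} {C : ℝ} (hf : Measurable f) (h : ∀ x, |f x| ≤ C) (x : ℝ) :
    gavg r (gavg s f) x = gavg (√(r ^ 2 + s ^ 2)) f x := by
  have hi : Integrable (fun p : ℝ × ℝ => f (x + (r * p.1 + s * p.2))) (gauss.prod gauss) :=
    integrable_of_measurable_of_bound (by fun_prop) fun p => h _
  rw [gavg, gavg, ← integral_gauss_prod_linear f hf, integral_prod _ hi]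
  simp only [gavg, add_assoc]

lemma hasDerivAt_gavg {r C M : ℝ} {f f₁ : ℝ → ℝ} (hf : Measurable f) (hC : ∀ x, |f x| ≤ C)
    (hd : ∀ x, HasDerivAt f (f₁ x) x) (hM : ∀ x, |f₁ x| ≤ M) (x : ℝ) :
    HasDerivAt (gavg r f) (gavg r f₁ x) x := by
  have hf₁ : Measurable f₁ := by
    rw [show f₁ = deriv f from funext fun x => (hd x).deriv.symm]; exact measurable_deriv f
  exact (hasDerivAt_integral_of_dominated_loc_of_deriv_le (s := Set.univ)
    (F := fun x t => f (x + r * t)) (F' := fun x t => f₁ (x + r * t)) (bound := fun _ => M)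
    univ_mem
    (Eventually.of_forall fun x => (by fun_prop : Measurable _).aestronglyMeasurable)
    (integrable_of_measurable_of_bound (by fun_prop) fun t => hC _)
    (by fun_prop : Measurable _).aestronglyMeasurable
    (ae_of_all _ fun t x _ => hM _) (integrable_const M)
    (ae_of_all _ fun t x _ => (hd (x + r * t)).comp_add_const x (r * t))).2

lemma BoundedJet.measurable₀ {M : ℝ} {f f₁ f₂ f₃ : ℝ → ℝ} (h : BoundedJet M f f₁ f₂ f₃) :
    Measurable f :=
  (continuous_iff_continuousAt.2 fun x => (h.d₁ x).continuousAt).measurable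

lemma BoundedJet.gavg {r C M : ℝ} {f f₁ f₂ f₃ : ℝ → ℝ} (h : BoundedJet M f f₁ f₂ f₃)
    (hC : ∀ x, |f x| ≤ C) : BoundedJet M (gavg r f) (gavg r f₁) (gavg r f₂) (gavg r f₃) := by
  have m₁ : Measurable f₁ :=
    (continuous_iff_continuousAt.2 fun x => (h.d₂ x).continuousAt).measurable
  have m₂ : Measurable f₂ :=
    (continuous_iff_continuousAt.2 fun x => (h.d₃ x).continuousAt).measurable
  have m₃ : Measurable f₃ := by
    rw [show f₃ = deriv f₂ from funext fun x => (h.d₃ x).deriv.symm]; exact measurable_deriv f₂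
  exact ⟨hasDerivAt_gavg h.measurable₀ hC h.d₁ h.b₁, hasDerivAt_gavg m₁ h.b₁ h.d₂ h.b₂,
    hasDerivAt_gavg m₂ h.b₂ h.d₃ h.b₃, abs_gavg_le m₁ h.b₁, abs_gavg_le m₂ h.b₂,
    abs_gavg_le m₃ h.b₃⟩

/-- A fourth moment of the standard Gaussian measure. -/
def gmoment : ℝ := ∫ t, (1 + |t|) ^ 4 ∂gauss

lemma gmoment_nonneg : 0 ≤ gmoment := integral_nonneg fun t => by positivity

lemma abs_gavg_taylor_le {r C M : ℝ} {f f₁ f₂ f₃ : ℝ → ℝ} (h : BoundedJet M f f₁ f₂ f₃)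
    (hC : ∀ x, |f x| ≤ C) (hr : 0 ≤ r) (x : ℝ) :
    |gavg r f x - f x - r ^ 2 * f₂ x / 2| ≤ M * gmoment * r ^ 3 := by
  have hM : 0 ≤ M := (abs_nonneg _).trans (h.b₁ 0)
  have hm := h.measurable₀
  have i0 : Integrable (fun t => f (x + r * t)) gauss :=
    integrable_of_measurable_of_bound (by fun_prop) fun t => hC _
  have i1 := integrable_id_gauss.const_mul (f₁ x * r)
  have i2 := integrable_sq_gauss.const_mul (f₂ x * r ^ 2 / 2)
  have ic : Integrable (fun _ : ℝ => f x) gauss := integrable_const _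
  have i01 : Integrable (fun t => f (x + r * t) - f x) gauss := i0.sub ic
  have i012 : Integrable (fun t => f (x + r * t) - f x - f₁ x * r * t) gauss := i01.sub i1
  have key : gavg r f x - f x - r ^ 2 * f₂ x / 2 =
      ∫ t, (f (x + r * t) - f x - f₁ x * r * t - f₂ x * r ^ 2 / 2 * t ^ 2) ∂gauss := by
    rw [integral_sub i012 i2, integral_sub i01 i1, integral_sub i0 ic,
      integral_const_mul, integral_const_mul, integral_sq_gauss, integral_id_gauss, _root_.gavg]
    simp
    ring
  rw [key, ← norm_eq_abs]
  refine (norm_integral_le_of_norm_le (integrable_one_add_abs_pow_four.const_mul (M * r ^ 3))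
    (ae_of_all _ fun t => ?_)).trans_eq ?_
  · have := abs_taylor_three_le h.d₁ h.d₂ h.d₃ h.b₃ x (r * t)
    rw [norm_eq_abs]
    calc _ = |f (x + r * t) - f x - f₁ x * (r * t) - f₂ x * (r * t) ^ 2 / 2| := by
          congr 1; ring
      _ ≤ M * |r * t| ^ 3 := this
      _ = M * r ^ 3 * |t| ^ 3 := by rw [abs_mul, abs_of_nonneg hr]; ring
      _ ≤ M * r ^ 3 * (1 + |t|) ^ 4 := by
          gcongr
          calc |t| ^ 3 ≤ (1 + |t|) ^ 3 := by gcongr; linarith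
            _ ≤ (1 + |t|) ^ 4 := pow_le_pow_right₀ (by linarith [abs_nonneg t]) (by norm_num)
  · rw [integral_const_mul, gmoment]; ring

lemma exists_gquant_gavg_le {ε M : ℝ} (hε : 0 < ε) (hM : 0 ≤ M) :
    ∃ C, 0 ≤ C ∧ ∀ f f₁ f₂ f₃ : ℝ → ℝ, BoundedJet M f f₁ f₂ f₃ →
      (∀ x, f x ∈ Set.Icc ε (1 - ε)) → ∀ r, 0 ≤ r → r ≤ 1 → ∀ x,
      gquant (gavg r f x) ≤
        gquant (f x) + r ^ 2 / 2 * (f₂ x * (gpdf (gquant (f x)))⁻¹) + C * r ^ 3 := by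
  obtain ⟨L, hL1, hL⟩ := exists_gquant_bound hε
  have hL0 : 0 ≤ L := zero_le_one.trans hL1
  have hm := gmoment_nonneg
  refine ⟨L ^ 3 * (M * (1 + gmoment)) ^ 2 + M * gmoment * L, by positivity,
    fun f f₁ f₂ f₃ hf hmem r hr0 hr1 x => ?_⟩
  have hb : ∀ x, |f x| ≤ max |ε| |1 - ε| := fun x => abs_le_max_abs_abs (hmem x).1 (hmem x).2
  have h1 := abs_gavg_taylor_le hf hb hr0 x
  have hq := gavg_mem_Icc (r := r) hf.measurable₀ hmem x
  have h2 := abs_gquant_sub_le hε hL (hmem x) hq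
  have hr32 : r ^ 3 ≤ r ^ 2 := pow_le_pow_of_le_one hr0 hr1 (by norm_num)
  have hr43 : r ^ 4 ≤ r ^ 3 := pow_le_pow_of_le_one hr0 hr1 (by norm_num)
  have h3 : |gavg r f x - f x| ≤ M * (1 + gmoment) * r ^ 2 := by
    calc _ = |(gavg r f x - f x - r ^ 2 * f₂ x / 2) + r ^ 2 * f₂ x / 2| := by congr 1; ring
      _ ≤ M * gmoment * r ^ 3 + r ^ 2 * M / 2 := by
          refine (abs_add_le _ _).trans (add_le_add h1 ?_)
          rw [abs_div, abs_mul, abs_two, abs_of_nonneg (sq_nonneg r)]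
          have := hf.b₂ x
          gcongr
      _ ≤ M * gmoment * r ^ 2 + r ^ 2 * M / 2 := by gcongr
      _ ≤ _ := by nlinarith [mul_nonneg hM (sq_nonneg r)]
  have h4 : L ^ 3 * |gavg r f x - f x| ^ 2 ≤ L ^ 3 * (M * (1 + gmoment)) ^ 2 * r ^ 3 := by
    calc _ ≤ L ^ 3 * (M * (1 + gmoment) * r ^ 2) ^ 2 := by gcongr
      _ = L ^ 3 * (M * (1 + gmoment)) ^ 2 * r ^ 4 := by ring
      _ ≤ _ := by gcongr
  have hw : 0 ≤ (gpdf (gquant (f x)))⁻¹ := (inv_pos.2 (gpdf_pos _)).le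
  have hwL := (hL _ (hmem x)).2
  have h5 : (gavg r f x - f x) * (gpdf (gquant (f x)))⁻¹ ≤
      r ^ 2 / 2 * (f₂ x * (gpdf (gquant (f x)))⁻¹) + M * gmoment * L * r ^ 3 := by
    have := (abs_le.1 h1).2
    calc _ ≤ (r ^ 2 * f₂ x / 2 + M * gmoment * r ^ 3) * (gpdf (gquant (f x)))⁻¹ := by
          gcongr; linarith
      _ = r ^ 2 / 2 * (f₂ x * (gpdf (gquant (f x)))⁻¹) +
          M * gmoment * r ^ 3 * (gpdf (gquant (f x)))⁻¹ := by ring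
      _ ≤ r ^ 2 / 2 * (f₂ x * (gpdf (gquant (f x)))⁻¹) + M * gmoment * r ^ 3 * L := by gcongr
      _ = _ := by ring
  linarith [(abs_le.1 h2).2]

lemma integral_gmoment_prod :
    Integrable (fun p : ℝ × ℝ => ((1 + |p.1|) * (1 + |p.2|)) ^ 4) (gauss.prod gauss) ∧
    ∫ p : ℝ × ℝ, ((1 + |p.1|) * (1 + |p.2|)) ^ 4 ∂(gauss.prod gauss) = gmoment ^ 2 := by
  simp only [mul_pow]
  refine ⟨integrable_one_add_abs_pow_four.mul_prod integrable_one_add_abs_pow_four, ?_⟩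
  rw [integral_prod_mul (fun t => (1 + |t|) ^ 4) (fun t => (1 + |t|) ^ 4), gmoment, sq]

lemma quadratic_expansion (T G r a b P Q m l U V ρ σ w p q E : ℝ) :
    T + G * r ^ 2 * (a * (P * m) + b * (Q * l)) + (G * r * (a * P + b * Q * ρ)) * p +
        (G * r * (b * Q * σ)) * q +
        (G * r ^ 2 * (a * U / 2 + b * V * ρ ^ 2 / 2) -
          w * G * r ^ 2 * (a * P + b * Q * ρ) ^ 2 / 2) * p ^ 2 +
        (G * r ^ 2 * (b * V * ρ * σ) - w * G * r ^ 2 * (a * P + b * Q * ρ) * (b * Q * σ)) *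
          (p * q) +
        (G * r ^ 2 * (b * V * σ ^ 2 / 2) - w * G * r ^ 2 * (b * Q * σ) ^ 2 / 2) * q ^ 2 - E =
      T + G * (r * (a * (P * p) + b * (Q * (ρ * p + σ * q))) +
          r ^ 2 * (a * (P * m + U * p ^ 2 / 2) + b * (Q * l + V * (ρ * p + σ * q) ^ 2 / 2)))
        - w * G * (r ^ 2 * (a * (P * p) + b * (Q * (ρ * p + σ * q))) ^ 2) / 2 - E := by
  ring

set_option maxHeartbeats 1000000 in
lemma exists_gavg_lower {a b ρ K : ℝ} (ha : 0 < a) (hb : 0 < b)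
    (hρ : a ^ 2 + b ^ 2 + 2 * a * b * ρ = 1) (hρ1 : ρ ^ 2 ≤ 1) (hK : 1 ≤ K) :
    ∃ C, 0 ≤ C ∧ ∀ U U₁ U₂ U₃ V V₁ V₂ V₃ h : ℝ → ℝ, ∀ e c : ℝ, BoundedJet K U U₁ U₂ U₃ →
      BoundedJet K V V₁ V₂ V₃ → (∀ x, |U x| ≤ K) → (∀ x, |V x| ≤ K) → Measurable h →
      (∀ z, |h z| ≤ c) → (∀ x y, gcdf (a * U x + b * V y) ≤ h (a * x + b * y) + e) →
      ∀ r, 0 ≤ r → r ≤ 1 → ∀ x y,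
      gcdf (a * U x + b * V y) + gpdf (a * U x + b * V y) * (r ^ 2 / 2 *
        (a * (U₂ x - U x * U₁ x ^ 2) + b * (V₂ y - V y * V₁ y ^ 2))) ≤
        gavg r h (a * x + b * y) + e + C * r ^ 3 := by
  have hK0 : 0 ≤ K := zero_le_one.trans hK
  have hσ := Real.sq_sqrt (sub_nonneg.2 hρ1)
  set σ := √(1 - ρ ^ 2) with hσdef
  set S := (a + b) * K * a ^ 2 + a * K + ((a + b) * K * b ^ 2 + b * K) with hS
  set K' := K + S * K / a + S * K / b with hK'
  have hS0 : 0 ≤ S := by positivity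
  have hKK' : K ≤ K' := by
    have h1 : 0 ≤ S * K / a := by positivity
    have h2 : 0 ≤ S * K / b := by positivity
    linarith
  set R := 10 * (a + b) * K' ^ 4 + 18 * (a + b) ^ 2 * K' ^ 6 + 8 * (a + b) ^ 3 * K' ^ 6 with hR
  have hK'0 : 0 ≤ K' := hK0.trans hKK'
  refine ⟨R * gmoment ^ 2, by positivity,
    fun U U₁ U₂ U₃ V V₁ V₂ V₃ h e c hU hV hUK hVK hh hc hyp r hr0 hr1 x y => ?_⟩
  clear_value σ S K' R
  set w := a * U x + b * V y with hw
  set P := U₁ x with hP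
  set Q := V₁ y with hQ
  set s := (w * a ^ 2 - a * U x) / 2 * P - (w * b ^ 2 - b * V y) / 2 * Q with hs
  have hw1 : |w| ≤ (a + b) * K := by
    calc _ ≤ |a * U x| + |b * V y| := abs_add_le _ _
      _ = a * |U x| + b * |V y| := by rw [abs_mul, abs_mul, abs_of_pos ha, abs_of_pos hb]
      _ ≤ a * K + b * K := by have := hUK x; have := hVK y; gcongr
      _ = _ := by ring
  have hs1 : |s| ≤ S * K := by
    have key : ∀ {d u p : ℝ}, 0 < d → |u| ≤ K → |p| ≤ K →
        |(w * d ^ 2 - d * u) / 2 * p| ≤ ((a + b) * K * d ^ 2 + d * K) * K := by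
      intro d u p hd hu hp
      rw [abs_mul, abs_div, abs_two]
      have h1 : |w * d ^ 2 - d * u| ≤ (a + b) * K * d ^ 2 + d * K := by
        refine (abs_sub _ _).trans ?_
        rw [abs_mul, abs_mul, abs_of_pos hd, abs_of_nonneg (sq_nonneg d)]
        gcongr
      have h2 := abs_nonneg (w * d ^ 2 - d * u)
      gcongr
      linarith
    calc _ ≤ _ := abs_sub _ _
      _ ≤ ((a + b) * K * a ^ 2 + a * K) * K + ((a + b) * K * b ^ 2 + b * K) * K :=
        add_le_add (key ha (hUK x) (hU.b₁ x)) (key hb (hVK y) (hV.b₁ y))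
      _ = _ := by rw [hS]; ring
  have hm : |s / a| ≤ K' := by
    rw [abs_div, abs_of_pos ha]
    have : |s| / a ≤ S * K / a := by gcongr
    have h2 : 0 ≤ S * K / b := by positivity
    linarith
  have hl : |-(s / b)| ≤ K' := by
    rw [abs_neg, abs_div, abs_of_pos hb]
    have : |s| / b ≤ S * K / b := by gcongr
    have h2 : 0 ≤ S * K / a := by positivity
    linarith
  set G := gpdf w with hG
  have hρabs : |ρ| ≤ 1 := abs_le_one_iff_mul_self_le_one.2 (by linarith [sq ρ])
  have hσabs : |σ| ≤ 1 := abs_le_one_iff_mul_self_le_one.2 (by nlinarith [sq_nonneg ρ])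
  clear_value s
  have pt : ∀ p : ℝ × ℝ,
      gcdf w + G * r ^ 2 * (a * (P * (s / a)) + b * (Q * (-(s / b)))) +
        (G * r * (a * P + b * Q * ρ)) * p.1 + (G * r * (b * Q * σ)) * p.2 +
        (G * r ^ 2 * (a * U₂ x / 2 + b * V₂ y * ρ ^ 2 / 2) -
          w * G * r ^ 2 * (a * P + b * Q * ρ) ^ 2 / 2) * p.1 ^ 2 +
        (G * r ^ 2 * (b * V₂ y * ρ * σ) - w * G * r ^ 2 * (a * P + b * Q * ρ) * (b * Q * σ)) *
          (p.1 * p.2) +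
        (G * r ^ 2 * (b * V₂ y * σ ^ 2 / 2) - w * G * r ^ 2 * (b * Q * σ) ^ 2 / 2) * p.2 ^ 2 -
        R * (r ^ 3 * ((1 + |p.1|) * (1 + |p.2|)) ^ 4) ≤
      h (a * x + b * y + (r * (a + b * ρ) * p.1 + r * (b * σ) * p.2)) + e := by
    intro p
    have hN : 1 ≤ (1 + |p.1|) * (1 + |p.2|) := by
      nlinarith [abs_nonneg p.1, abs_nonneg p.2, mul_nonneg (abs_nonneg p.1) (abs_nonneg p.2)]
    have hξ : |p.1| ≤ (1 + |p.1|) * (1 + |p.2|) := by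
      nlinarith [abs_nonneg p.1, abs_nonneg p.2, mul_nonneg (abs_nonneg p.1) (abs_nonneg p.2)]
    have hη : |ρ * p.1 + σ * p.2| ≤ (1 + |p.1|) * (1 + |p.2|) := by
      calc _ ≤ |ρ| * |p.1| + |σ| * |p.2| := by
            rw [← abs_mul, ← abs_mul]; exact abs_add_le _ _
        _ ≤ 1 * |p.1| + 1 * |p.2| := by gcongr
        _ ≤ _ := by
          nlinarith [abs_nonneg p.1, abs_nonneg p.2, mul_nonneg (abs_nonneg p.1) (abs_nonneg p.2)]
    have h1 := gcdf_jet_shift_lower ha hb (hK.trans hKK') (hU.mono hKK') (hV.mono hKK') hr0 hr1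
      hN hξ hη hm hl x y
    have h2 := hyp (x + (r * p.1 + r ^ 2 * (s / a)))
      (y + (r * (ρ * p.1 + σ * p.2) + r ^ 2 * (-(s / b))))
    rw [show a * (x + (r * p.1 + r ^ 2 * (s / a))) +
        b * (y + (r * (ρ * p.1 + σ * p.2) + r ^ 2 * (-(s / b)))) =
        a * x + b * y + (r * (a + b * ρ) * p.1 + r * (b * σ) * p.2) by field_simp; ring] at h2
    refine le_trans (le_of_eq ?_) (h1.trans h2)
    rw [← hw, ← hG, ← hP, ← hQ, ← hR]
    exact quadratic_expansion ..
  obtain ⟨qi, qe⟩ := integral_gauss_prod_quadratic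
    (gcdf w + G * r ^ 2 * (a * (P * (s / a)) + b * (Q * (-(s / b)))))
    (G * r * (a * P + b * Q * ρ)) (G * r * (b * Q * σ))
    (G * r ^ 2 * (a * U₂ x / 2 + b * V₂ y * ρ ^ 2 / 2) -
      w * G * r ^ 2 * (a * P + b * Q * ρ) ^ 2 / 2)
    (G * r ^ 2 * (b * V₂ y * ρ * σ) - w * G * r ^ 2 * (a * P + b * Q * ρ) * (b * Q * σ))
    (G * r ^ 2 * (b * V₂ y * σ ^ 2 / 2) - w * G * r ^ 2 * (b * Q * σ) ^ 2 / 2)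
  obtain ⟨mi, me⟩ := integral_gmoment_prod
  have hhi : Integrable (fun p : ℝ × ℝ =>
      h (a * x + b * y + (r * (a + b * ρ) * p.1 + r * (b * σ) * p.2))) (gauss.prod gauss) :=
    integrable_of_measurable_of_bound (hh.comp (by fun_prop)) fun p => hc _
  have hei : Integrable (fun _ : ℝ × ℝ => e) (gauss.prod gauss) := integrable_const _
  have main := integral_mono (qi.sub ((mi.const_mul (r ^ 3)).const_mul R)) (hhi.add hei) pt
  rw [integral_sub' qi ((mi.const_mul _).const_mul _), integral_add' hhi hei, qe,
    integral_const_mul, integral_const_mul, me,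
    integral_gauss_prod_linear h hh] at main
  rw [show √((r * (a + b * ρ)) ^ 2 + (r * (b * σ)) ^ 2) = r by
    rw [show (r * (a + b * ρ)) ^ 2 + (r * (b * σ)) ^ 2 = r ^ 2 by
      linear_combination r ^ 2 * hρ + r ^ 2 * b ^ 2 * hσ]
    exact Real.sqrt_sq hr0] at main
  simp only [integral_const, probReal_univ, one_smul] at main
  have e1 : a * (P * (s / a)) + b * (Q * (-(s / b))) = (P - Q) * s := by field_simp; ring
  rw [e1] at main
  clear_value w P Q G
  have e2 : (P - Q) * s + (a * U₂ x / 2 + b * V₂ y * ρ ^ 2 / 2) + (b * V₂ y * σ ^ 2 / 2) -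
      w * (a * P + b * Q * ρ) ^ 2 / 2 - w * (b * Q * σ) ^ 2 / 2 =
      (a * (U₂ x - U x * P ^ 2) + b * (V₂ y - V y * Q ^ 2)) / 2 := by
    rw [hs]
    linear_combination (b * V₂ y / 2 - w * b ^ 2 * Q ^ 2 / 2) * hσ - w * P * Q / 2 * hρ -
      P * Q / 2 * hw
  rw [gavg]
  have e3 := congrArg (fun t => G * r ^ 2 * t) e2
  linarith [main, e3]

lemma exists_gavg_step {a b ρ ε M : ℝ} (ha : 0 < a) (hb : 0 < b)
    (hρ : a ^ 2 + b ^ 2 + 2 * a * b * ρ = 1) (hρ1 : ρ ^ 2 ≤ 1) (hε : 0 < ε) (hM : 0 ≤ M) :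
    ∃ C, 0 ≤ C ∧ ∀ f f₁ f₂ f₃ g g₁ g₂ g₃ h : ℝ → ℝ, ∀ e c : ℝ, BoundedJet M f f₁ f₂ f₃ →
      BoundedJet M g g₁ g₂ g₃ → (∀ x, f x ∈ Set.Icc ε (1 - ε)) →
      (∀ x, g x ∈ Set.Icc ε (1 - ε)) → Measurable h → (∀ z, |h z| ≤ c) →
      (∀ x y, gcdf (a * gquant (f x) + b * gquant (g y)) ≤ h (a * x + b * y) + e) →
      ∀ r, 0 ≤ r → r ≤ 1 → ∀ x y,
      gcdf (a * gquant (gavg r f x) + b * gquant (gavg r g y)) ≤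
        gavg r h (a * x + b * y) + e + C * r ^ 3 := by
  obtain ⟨K, hK, hchain⟩ := exists_boundedJet_gquant_comp hε hM
  obtain ⟨C₁, hC₁, hlow⟩ := exists_gavg_lower ha hb hρ hρ1 hK
  obtain ⟨C₂, hC₂, hup⟩ := exists_gquant_gavg_le hε hM
  have hK0 : 0 ≤ K := zero_le_one.trans hK
  refine ⟨C₁ + (a + b) * C₂ + ((a + b) * (K + K ^ 3 + C₂)) ^ 2, by positivity,
    fun f f₁ f₂ f₃ g g₁ g₂ g₃ h e c hf hg hfm hgm hh hc hyp r hr0 hr1 x y => ?_⟩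
  obtain ⟨U₁, U₂, U₃, hU, hU', hUK⟩ := hchain f f₁ f₂ f₃ hf hfm
  obtain ⟨V₁, V₂, V₃, hV, hV', hVK⟩ := hchain g g₁ g₂ g₃ hg hgm
  have h1 := hlow _ _ _ _ _ _ _ _ h e c hU hV hUK hVK hh hc hyp r hr0 hr1 x y
  have h2 := hup f f₁ f₂ f₃ hf hfm r hr0 hr1 x
  have h3 := hup g g₁ g₂ g₃ hg hgm r hr0 hr1 y
  rw [hU'] at h2
  rw [hV'] at h3
  have key : ∀ {u u₁ u₂ : ℝ}, |u| ≤ K → |u₁| ≤ K → |u₂| ≤ K → |u₂ - u * u₁ ^ 2| ≤ K + K ^ 3 := by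
    intro u u₁ u₂ h0 h1 h2
    calc _ ≤ |u₂| + |u| * |u₁| ^ 2 := by
          rw [← abs_pow, ← abs_mul]; exact abs_sub _ _
      _ ≤ K + K * K ^ 2 := by gcongr
      _ = _ := by ring
  have hX := key (hUK x) (hU.b₁ x) (hU.b₂ x)
  have hY := key (hVK y) (hV.b₁ y) (hV.b₂ y)
  set X := U₂ x - gquant (f x) * U₁ x ^ 2
  set Y := V₂ y - gquant (g y) * V₁ y ^ 2
  set w := a * gquant (f x) + b * gquant (g y) with hw
  set θ := r ^ 2 / 2 * (a * X + b * Y) + (a + b) * C₂ * r ^ 3 with hθ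
  have hr32 : r ^ 3 ≤ r ^ 2 := pow_le_pow_of_le_one hr0 hr1 (by norm_num)
  have hr43 : r ^ 4 ≤ r ^ 3 := pow_le_pow_of_le_one hr0 hr1 (by norm_num)
  have h4 : a * gquant (gavg r f x) + b * gquant (gavg r g y) ≤ w + θ := by
    have := add_le_add (mul_le_mul_of_nonneg_left h2 ha.le) (mul_le_mul_of_nonneg_left h3 hb.le)
    rw [hw, hθ]; linarith
  have h5 : |a * X + b * Y| ≤ (a + b) * (K + K ^ 3) := by
    calc _ ≤ a * |X| + b * |Y| := by
          rw [← abs_of_pos ha, ← abs_of_pos hb, ← abs_mul, ← abs_mul, abs_of_pos ha,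
            abs_of_pos hb]
          exact abs_add_le _ _
      _ ≤ a * (K + K ^ 3) + b * (K + K ^ 3) := by gcongr
      _ = _ := by ring
  have h6 : |θ| ≤ (a + b) * (K + K ^ 3 + C₂) * r ^ 2 := by
    calc _ ≤ r ^ 2 / 2 * |a * X + b * Y| + (a + b) * C₂ * r ^ 3 := by
          refine (abs_add_le _ _).trans_eq ?_
          rw [abs_mul, abs_of_nonneg (by positivity : 0 ≤ r ^ 2 / 2),
            abs_of_nonneg (by positivity : 0 ≤ (a + b) * C₂ * r ^ 3)]
      _ ≤ r ^ 2 * ((a + b) * (K + K ^ 3)) + (a + b) * C₂ * r ^ 2 := by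
          gcongr
          linarith [sq_nonneg r]
      _ = _ := by ring
  have h7 : |θ| ^ 2 ≤ ((a + b) * (K + K ^ 3 + C₂)) ^ 2 * r ^ 3 := by
    calc _ ≤ ((a + b) * (K + K ^ 3 + C₂) * r ^ 2) ^ 2 := by gcongr
      _ = ((a + b) * (K + K ^ 3 + C₂)) ^ 2 * r ^ 4 := by ring
      _ ≤ _ := by gcongr
  have h8 := (abs_le.1 (abs_gcdf_taylor_two_le w θ)).2
  have h9 := strictMono_gcdf.monotone h4
  have h10 : gpdf w * ((a + b) * C₂ * r ^ 3) ≤ (a + b) * C₂ * r ^ 3 :=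
    mul_le_of_le_one_left (by positivity) ((le_abs_self _).trans (abs_gpdf_le_one w))
  have h11 : gpdf w * θ = gpdf w * (r ^ 2 / 2 * (a * X + b * Y)) +
    gpdf w * ((a + b) * C₂ * r ^ 3) := by rw [hθ]; ring
  linarith

lemma gavg_zero (f : ℝ → ℝ) : gavg 0 f = f := by
  ext x; simp [gavg]

lemma ehrhard_of_boundedJet {a b ρ ε M : ℝ} (ha : 0 < a) (hb : 0 < b)
    (hρ : a ^ 2 + b ^ 2 + 2 * a * b * ρ = 1) (hρ1 : ρ ^ 2 ≤ 1) (hε : 0 < ε) {c : ℝ}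
    {f f₁ f₂ f₃ g g₁ g₂ g₃ h : ℝ → ℝ} (hf : BoundedJet M f f₁ f₂ f₃)
    (hg : BoundedJet M g g₁ g₂ g₃) (hfm : ∀ x, f x ∈ Set.Icc ε (1 - ε))
    (hgm : ∀ x, g x ∈ Set.Icc ε (1 - ε)) (hh : Measurable h) (hc : ∀ z, |h z| ≤ c)
    (hyp : ∀ x y, gcdf (a * gquant (f x) + b * gquant (g y)) ≤ h (a * x + b * y)) :
    gcdf (a * gquant (∫ x, f x ∂gauss) + b * gquant (∫ x, g x ∂gauss)) ≤ ∫ x, h x ∂gauss := by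
  have hM : 0 ≤ M := (abs_nonneg _).trans (hf.b₁ 0)
  obtain ⟨C, hC, step⟩ := exists_gavg_step ha hb hρ hρ1 hε hM
  have hbd : ∀ {f : ℝ → ℝ}, (∀ x, f x ∈ Set.Icc ε (1 - ε)) → ∀ x, |f x| ≤ max |ε| |1 - ε| :=
    fun h x => abs_le_max_abs_abs (h x).1 (h x).2
  have iter : ∀ r, 0 ≤ r → r ≤ 1 → ∀ k : ℕ, ∀ x y,
      gcdf (a * gquant (gavg (√k * r) f x) + b * gquant (gavg (√k * r) g y)) ≤
        gavg (√k * r) h (a * x + b * y) + k * (C * r ^ 3) := by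
    intro r hr0 hr1 k
    induction k with
    | zero => simpa [gavg_zero] using hyp
    | succ k ih =>
      intro x y
      have hsq : √(r ^ 2 + (√k * r) ^ 2) = √((k + 1 : ℕ) : ℝ) * r := by
        rw [show r ^ 2 + (√k * r) ^ 2 = ((k + 1 : ℕ) : ℝ) * r ^ 2 by
          rw [mul_pow, Real.sq_sqrt (Nat.cast_nonneg k)]; push_cast; ring]
        rw [Real.sqrt_mul (Nat.cast_nonneg _), Real.sqrt_sq hr0]
      have := step _ _ _ _ _ _ _ _ _ _ c (hf.gavg (r := √k * r) (hbd hfm))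
        (hg.gavg (r := √k * r) (hbd hgm))
        (gavg_mem_Icc hf.measurable₀ hfm) (gavg_mem_Icc hg.measurable₀ hgm)
        (measurable_gavg hh) (abs_gavg_le hh hc) ih r hr0 hr1 x y
      rw [gavg_gavg hf.measurable₀ (hbd hfm), gavg_gavg hg.measurable₀ (hbd hgm),
        gavg_gavg hh hc, hsq] at this
      refine this.trans_eq ?_
      push_cast; ring
  have lim : Tendsto (fun N : ℕ => ∫ x, h x ∂gauss + C * (1 / √((N : ℝ) + 1))) atTop
      (𝓝 (∫ x, h x ∂gauss + C * 0)) := by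
    refine tendsto_const_nhds.add (Tendsto.const_mul C ?_)
    have h1 := (tendsto_one_div_add_atTop_nhds_zero_nat (𝕜 := ℝ)).sqrt
    simpa using h1
  rw [mul_zero, add_zero] at lim
  refine ge_of_tendsto' lim fun N => ?_
  have hN : (0 : ℝ) < √((N : ℝ) + 1) := Real.sqrt_pos.2 (by positivity)
  have h1 : (1 : ℝ) ≤ √((N : ℝ) + 1) := Real.one_le_sqrt.2 (by linarith [N.cast_nonneg (α := ℝ)])
  have := iter (1 / √((N : ℝ) + 1)) (by positivity) ((div_le_one hN).2 h1) (N + 1) 0 0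
  rw [show √((N + 1 : ℕ) : ℝ) * (1 / √((N : ℝ) + 1)) = 1 by
    push_cast; field_simp] at this
  simp only [gavg, mul_zero, zero_add, one_mul, add_zero] at this
  refine this.trans_eq ?_
  congr 1
  have h2 : √((N : ℝ) + 1) ^ 2 = N + 1 := Real.sq_sqrt (by positivity)
  push_cast
  generalize √((N : ℝ) + 1) = s at hN h2 ⊢
  rw [← h2]
  field_simp

lemma BoundedJet.comp_const_mul {M a : ℝ} {U U₁ U₂ U₃ : ℝ → ℝ} (h : BoundedJet M U U₁ U₂ U₃)
    (ha : 0 < a) :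
    BoundedJet (a * M + a ^ 2 * M + a ^ 3 * M) (fun x => U (a * x)) (fun x => a * U₁ (a * x))
      (fun x => a ^ 2 * U₂ (a * x)) (fun x => a ^ 3 * U₃ (a * x)) := by
  have hM : 0 ≤ M := (abs_nonneg _).trans (h.b₁ 0)
  have lin : ∀ x, HasDerivAt (fun x => a * x) a x := fun x => by
    simpa using (hasDerivAt_id x).const_mul a
  have p1 : 0 ≤ a * M := by positivity
  have p2 : 0 ≤ a ^ 2 * M := by positivity
  have p3 : 0 ≤ a ^ 3 * M := by positivity
  refine ⟨fun x => ?_, fun x => ?_, fun x => ?_, fun x => ?_, fun x => ?_, fun x => ?_⟩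
  · exact ((h.d₁ (a * x)).comp x (lin x)).congr_deriv (by ring)
  · exact (((h.d₂ (a * x)).comp x (lin x)).const_mul a).congr_deriv (by ring)
  · exact (((h.d₃ (a * x)).comp x (lin x)).const_mul (a ^ 2)).congr_deriv (by ring)
  · rw [abs_mul, abs_of_pos ha]
    have := mul_le_mul_of_nonneg_left (h.b₁ (a * x)) ha.le
    linarith
  · rw [abs_mul, abs_of_pos (pow_pos ha 2)]
    have := mul_le_mul_of_nonneg_left (h.b₂ (a * x)) (pow_pos ha 2).le
    linarith
  · rw [abs_mul, abs_of_pos (pow_pos ha 3)]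
    have := mul_le_mul_of_nonneg_left (h.b₃ (a * x)) (pow_pos ha 3).le
    linarith

lemma BoundedJet.gcdf_comp {M L : ℝ} {U U₁ U₂ U₃ : ℝ → ℝ} (h : BoundedJet M U U₁ U₂ U₃)
    (hL : ∀ x, |U x| ≤ L) :
    ∃ M' f₁ f₂ f₃, BoundedJet M' (fun x => gcdf (U x)) f₁ f₂ f₃ := by
  have hM : 0 ≤ M := (abs_nonneg _).trans (h.b₁ 0)
  have hL0 : 0 ≤ L := (abs_nonneg _).trans (hL 0)
  have dG : ∀ x, HasDerivAt (fun x => gpdf (U x)) (-(U x * gpdf (U x)) * U₁ x) x := fun x =>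
    (hasDerivAt_gpdf (U x)).comp x (h.d₁ x)
  have bG : ∀ x, |gpdf (U x)| ≤ 1 := fun x => abs_gpdf_le_one _
  set M₂ := M + L * M ^ 2 with hM₂
  set M₃ := L * M * M₂ + (M + (M * M ^ 2 + L * (2 * M * M))) with hM₃
  have p2 : 0 ≤ M₂ := by positivity
  have p3 : 0 ≤ M₃ := by positivity
  have b2 : ∀ x, |U₂ x - U x * U₁ x ^ 2| ≤ M₂ := fun x => by
    have h0 := hL x
    have h1 := h.b₁ x
    have h2 := h.b₂ x
    calc _ ≤ |U₂ x| + |U x| * |U₁ x| ^ 2 := by rw [← abs_pow, ← abs_mul]; exact abs_sub _ _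
      _ ≤ _ := by rw [hM₂]; gcongr
  refine ⟨M + M₂ + M₃, fun x => gpdf (U x) * U₁ x,
    fun x => gpdf (U x) * (U₂ x - U x * U₁ x ^ 2),
    fun x => -(U x * gpdf (U x)) * U₁ x * (U₂ x - U x * U₁ x ^ 2) +
      gpdf (U x) * (U₃ x - (U₁ x * U₁ x ^ 2 + U x * (2 * U₁ x * U₂ x))),
    fun x => (hasDerivAt_gcdf (U x)).comp x (h.d₁ x), fun x => ?_, fun x => ?_, fun x => ?_,
    fun x => ?_, fun x => ?_⟩
  · exact ((dG x).mul (h.d₂ x)).congr_deriv (by ring)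
  · refine ((dG x).mul ((h.d₃ x).sub ((h.d₁ x).mul ((h.d₂ x).pow 2)))).congr_deriv ?_
    simp
  · rw [abs_mul]
    calc _ ≤ 1 * M := mul_le_mul (bG x) (h.b₁ x) (abs_nonneg _) zero_le_one
      _ ≤ _ := by linarith
  · rw [abs_mul]
    calc _ ≤ 1 * M₂ := mul_le_mul (bG x) (b2 x) (abs_nonneg _) zero_le_one
      _ ≤ _ := by linarith
  · have h0 := hL x
    have h1 := h.b₁ x
    have h2 := h.b₂ x
    have h3 := h.b₃ x
    have hb := b2 x
    have hg := bG x
    calc _ ≤ |-(U x * gpdf (U x)) * U₁ x * (U₂ x - U x * U₁ x ^ 2)| +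
          |gpdf (U x) * (U₃ x - (U₁ x * U₁ x ^ 2 + U x * (2 * U₁ x * U₂ x)))| := abs_add_le _ _
      _ ≤ L * M * M₂ + 1 * (M + (M * M ^ 2 + L * (2 * M * M))) := by
          refine add_le_add ?_ ?_
          · rw [abs_mul, abs_mul, abs_neg, abs_mul]
            calc _ ≤ L * 1 * M * M₂ := by gcongr
              _ = _ := by ring
          · rw [abs_mul]
            gcongr
            refine (abs_sub _ _).trans ?_
            gcongr
            refine (abs_add_le _ _).trans ?_
            rw [abs_mul, abs_mul, abs_mul, abs_mul, abs_pow, abs_two]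
            gcongr
      _ ≤ _ := by rw [hM₃]; linarith

/-- Convolution of `U` with the kernel `κ`. -/
def mollify (κ U : ℝ → ℝ) (x : ℝ) : ℝ := ∫ t, κ t * U (x - t)

lemma mollify_eq_convolution (κ U : ℝ → ℝ) :
    mollify κ U = convolution κ U (ContinuousLinearMap.lsmul ℝ ℝ) volume := by
  ext x; simp [mollify, convolution_def]

lemma integrable_kernel_mul {κ U : ℝ → ℝ} {L : ℝ} (hκ : Integrable κ) (hU : Measurable U)
    (hL : ∀ x, |U x| ≤ L) : Integrable fun t => κ t * U t :=
  hκ.mul_bdd hU.aestronglyMeasurable (ae_of_all _ hL)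

lemma abs_mollify_le {κ U : ℝ → ℝ} {L : ℝ} (hκ : Integrable κ) (hL : ∀ x, |U x| ≤ L) (x : ℝ) :
    |mollify κ U x| ≤ L * ∫ t, |κ t| := by
  rw [← norm_eq_abs, mollify, ← integral_const_mul]
  refine norm_integral_le_of_norm_le (hκ.abs.const_mul L) (ae_of_all _ fun t => ?_)
  rw [norm_eq_abs, abs_mul, mul_comm]
  have := hL (x - t)
  gcongr

lemma hasDerivAt_mollify {κ U : ℝ → ℝ} {L : ℝ} (hκ : HasCompactSupport κ) (hκ' : ContDiff ℝ 1 κ)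
    (hU : Measurable U) (hL : ∀ x, |U x| ≤ L) (x : ℝ) :
    HasDerivAt (mollify κ U) (mollify (deriv κ) U x) x := by
  rw [mollify_eq_convolution, mollify_eq_convolution]
  refine hκ.hasDerivAt_convolution_left _ hκ' ?_ x
  exact (locallyIntegrable_const L).mono hU.aestronglyMeasurable
    (ae_of_all _ fun x => (hL x).trans (le_abs_self L))

lemma exists_boundedJet_mollify {κ U : ℝ → ℝ} {L : ℝ} (hκ : HasCompactSupport κ)
    (hκ' : ContDiff ℝ 4 κ) (hU : Measurable U) (hL : ∀ x, |U x| ≤ L) :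
    ∃ M U₁ U₂ U₃, BoundedJet M (mollify κ U) U₁ U₂ U₃ := by
  have s1 : ContDiff ℝ 3 (deriv κ) := by
    have : ContDiff ℝ (3 + 1) κ := by exact_mod_cast hκ'
    exact (contDiff_succ_iff_deriv.1 this).2.2
  have s2 : ContDiff ℝ 2 (deriv (deriv κ)) := by
    have : ContDiff ℝ (2 + 1) (deriv κ) := by exact_mod_cast s1
    exact (contDiff_succ_iff_deriv.1 this).2.2
  have s3 : ContDiff ℝ 1 (deriv (deriv (deriv κ))) := by
    have : ContDiff ℝ (1 + 1) (deriv (deriv κ)) := by exact_mod_cast s2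
    exact (contDiff_succ_iff_deriv.1 this).2.2
  have i1 := s1.continuous.integrable_of_hasCompactSupport (μ := volume) hκ.deriv
  have i2 := s2.continuous.integrable_of_hasCompactSupport (μ := volume) hκ.deriv.deriv
  have i3 := s3.continuous.integrable_of_hasCompactSupport (μ := volume) hκ.deriv.deriv.deriv
  exact ⟨max (max (L * ∫ t, |deriv κ t|) (L * ∫ t, |deriv (deriv κ) t|))
      (L * ∫ t, |deriv (deriv (deriv κ)) t|), _, _, _,
    hasDerivAt_mollify hκ (hκ'.of_le (by norm_num)) hU hL,
    hasDerivAt_mollify hκ.deriv (s1.of_le (by norm_num)) hU hL,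
    hasDerivAt_mollify hκ.deriv.deriv (s2.of_le (by norm_num)) hU hL,
    fun x => (abs_mollify_le i1 hL x).trans ((le_max_left _ _).trans (le_max_left _ _)),
    fun x => (abs_mollify_le i2 hL x).trans ((le_max_right _ _).trans (le_max_left _ _)),
    fun x => (abs_mollify_le i3 hL x).trans (le_max_right _ _)⟩

lemma mollify_mem_Icc {κ U : ℝ → ℝ} {c d : ℝ} (hκ : Integrable κ) (hκ0 : ∀ t, 0 ≤ κ t)
    (hκ1 : ∫ t, κ t = 1) (hU : Measurable U) (h : ∀ x, U x ∈ Set.Icc c d) (x : ℝ) :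
    mollify κ U x ∈ Set.Icc c d := by
  have hi : Integrable fun t => κ t * U (x - t) :=
    integrable_kernel_mul hκ (hU.comp (measurable_id.const_sub x)) fun t =>
      abs_le_max_abs_abs (h _).1 (h _).2
  constructor
  · calc c = ∫ t, κ t * c := by rw [integral_mul_const, hκ1, one_mul]
      _ ≤ _ := integral_mono (hκ.mul_const c) hi fun t =>
          mul_le_mul_of_nonneg_left (h _).1 (hκ0 t)
  · calc _ ≤ ∫ t, κ t * d := integral_mono hi (hκ.mul_const d) fun t =>
          mul_le_mul_of_nonneg_left (h _).2 (hκ0 t)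
      _ = d := by rw [integral_mul_const, hκ1, one_mul]

lemma mollify_add_mollify_le {κ U V : ℝ → ℝ} {a b L c : ℝ} (hκ : Integrable κ)
    (hκ0 : ∀ t, 0 ≤ κ t) (hκ1 : ∫ t, κ t = 1) (hκe : ∀ t, κ (-t) = κ t)
    (hU : Measurable U) (hV : Measurable V) (hUL : ∀ x, |U x| ≤ L) (hVL : ∀ x, |V x| ≤ L)
    {x y : ℝ} (h : ∀ᵐ u, a * U (x + y - u) + b * V u ≤ c) :
    a * mollify κ U x + b * mollify κ V y ≤ c := by
  have iU : Integrable fun t => κ t * U (x - t) :=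
    integrable_kernel_mul hκ (hU.comp (measurable_id.const_sub x)) fun t => hUL _
  have iV : Integrable fun t => κ t * V (y + t) :=
    integrable_kernel_mul hκ (hV.comp (measurable_id.const_add y)) fun t => hVL _
  have e : mollify κ V y = ∫ t, κ t * V (y + t) := by
    rw [mollify, ← integral_neg_eq_self]
    simp only [hκe, sub_neg_eq_add]
  have h' : ∀ᵐ t, a * U (x - t) + b * V (y + t) ≤ c := by
    filter_upwards [(measurePreserving_add_left volume y).quasiMeasurePreserving.ae h] with t ht
    rwa [show x + y - (y + t) = x - t by ring] at ht
  rw [e, mollify, ← integral_const_mul, ← integral_const_mul,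
    ← integral_add (iU.const_mul a) (iV.const_mul b)]
  calc _ ≤ ∫ t, κ t * c := by
        refine integral_mono_ae ((iU.const_mul a).add (iV.const_mul b)) (hκ.mul_const c) ?_
        filter_upwards [h'] with t ht
        have := mul_le_mul_of_nonneg_left ht (hκ0 t)
        linarith
    _ = c := by rw [integral_mul_const, hκ1, one_mul]

/-- Ehrhard's functional inequality for `γ`, with functions bounded away from `0` and `1` and
with exceptional sets negligible for the reference measure `ν`. -/
def EhrhardInequality (a b : ℝ) {X : Type*} [AddCommGroup X] [Module ℝ X] [MeasurableSpace X]
    (ν γ : Measure X) : Prop :=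
  ∀ ε : ℝ, 0 < ε → ∀ f g h : X → ℝ, Measurable f → Measurable g → Measurable h →
    (∀ x, f x ∈ Set.Icc ε (1 - ε)) → (∀ x, g x ∈ Set.Icc ε (1 - ε)) →
    (∀ x, h x ∈ Set.Icc (0 : ℝ) 1) →
    (∀ᵐ z ∂ν, ∀ᵐ u ∂ν, gcdf (a * gquant (f (a⁻¹ • (z - u))) + b * gquant (g (b⁻¹ • u))) ≤ h z) →
    gcdf (a * gquant (∫ x, f x ∂γ) + b * gquant (∫ x, g x ∂γ)) ≤ ∫ x, h x ∂γ

/-- A shrinking sequence of smooth bumps centred at the origin. -/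
def bumpSeq (n : ℕ) : ContDiffBump (0 : ℝ) :=
  ⟨1 / (2 * ((n : ℝ) + 1)), 1 / ((n : ℝ) + 1), by positivity, by
    rw [mul_comm, ← div_div]; exact half_lt_self (by positivity)⟩

/-- The normalized kernels of `bumpSeq`. -/
def bumpKernel (n : ℕ) : ℝ → ℝ := (bumpSeq n).normed volume

lemma hasCompactSupport_bumpKernel (n : ℕ) : HasCompactSupport (bumpKernel n) :=
  (bumpSeq n).hasCompactSupport_normed

lemma contDiff_bumpKernel (n : ℕ) : ContDiff ℝ 4 (bumpKernel n) := by
  exact_mod_cast (bumpSeq n).contDiff_normed (μ := volume) (n := 4)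

lemma tendsto_mollify_bumpKernel {U : ℝ → ℝ} {L : ℝ} (hU : Measurable U) (hL : ∀ x, |U x| ≤ L) :
    ∀ᵐ x, Tendsto (fun n => mollify (bumpKernel n) U x) atTop (𝓝 (U x)) := by
  simp only [mollify_eq_convolution]
  refine ContDiffBump.ae_convolution_tendsto_right_of_locallyIntegrable (φ := bumpSeq) (K := 2)
    tendsto_one_div_add_atTop_nhds_zero_nat (Eventually.of_forall fun n => ?_) ?_
  · refine le_of_eq ?_
    simp only [bumpSeq]
    field_simp
  · exact (locallyIntegrable_const L).mono hU.aestronglyMeasurable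
      (ae_of_all _ fun x => (hL x).trans (le_abs_self L))

lemma tendsto_integral_gcdf_mollify {f : ℝ → ℝ} {ε a : ℝ} (ha : 0 < a) (hε : 0 < ε)
    (hf : Measurable f) (hfm : ∀ x, f x ∈ Set.Icc ε (1 - ε)) :
    Tendsto (fun n => ∫ x, gcdf (mollify (bumpKernel n) (fun y => gquant (f (a⁻¹ * y))) (a * x))
      ∂gauss) atTop (𝓝 (∫ x, f x ∂gauss)) := by
  obtain ⟨L, hL1, hL⟩ := exists_gquant_bound hε
  have hUm : Measurable fun y => gquant (f (a⁻¹ * y)) :=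
    measurable_gquant.comp (hf.comp (measurable_const_mul _))
  have hUL : ∀ y, |gquant (f (a⁻¹ * y))| ≤ L := fun y => (hL _ (hfm _)).1
  have hae := tendsto_mollify_bumpKernel hUm hUL
  have hq : Measure.QuasiMeasurePreserving (fun x : ℝ => a * x) volume volume := by
    refine ⟨measurable_const_mul a, ?_⟩
    rw [Real.map_volume_mul_left ha.ne']
    exact Measure.smul_absolutelyContinuous
  have hae' := hq.ae hae
  have hae'' := (gaussianReal_absolutelyContinuous 0 (one_ne_zero)).ae_le hae'
  refine tendsto_integral_of_dominated_convergence (fun _ => 1) (fun n => ?_)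
    (integrable_const _) (fun n => ae_of_all _ fun x => ?_) ?_
  · obtain ⟨M, _, _, _, hJ⟩ := exists_boundedJet_mollify (hasCompactSupport_bumpKernel n)
      (contDiff_bumpKernel n) hUm hUL
    exact (continuous_gcdf.measurable.comp
      (hJ.measurable₀.comp (measurable_const_mul a))).aestronglyMeasurable
  · have := gcdf_mem_Ioo (mollify (bumpKernel n) (fun y => gquant (f (a⁻¹ * y))) (a * x))
    rw [norm_eq_abs, abs_of_pos this.1]; exact this.2.le
  · filter_upwards [hae''] with x hx
    have := (continuous_gcdf.tendsto _).comp hx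
    rw [inv_mul_cancel_left₀ ha.ne', gcdf_gquant (mem_Ioo_of_mem_Icc hε (hfm x))] at this
    exact this

theorem ehrhardInequality_gauss {a b ρ : ℝ} (ha : 0 < a) (hb : 0 < b)
    (hρ : a ^ 2 + b ^ 2 + 2 * a * b * ρ = 1) (hρ1 : ρ ^ 2 ≤ 1) :
    EhrhardInequality a b (volume : Measure ℝ) gauss := by
  intro ε hε f g h hf hg hh hfm hgm hhm hyp
  obtain ⟨L, hL1, hL⟩ := exists_gquant_bound hε
  set B : Set ℝ := toMeasurable volume {z | ¬ ∀ᵐ u, gcdf (a * gquant (f (a⁻¹ • (z - u))) +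
    b * gquant (g (b⁻¹ • u))) ≤ h z} with hB
  have hBm : MeasurableSet B := measurableSet_toMeasurable _ _
  have hB0 : volume B = 0 := by rw [hB, measure_toMeasurable]; exact hyp
  have hBg : ∀ z ∉ B, ∀ᵐ u, gcdf (a * gquant (f (a⁻¹ • (z - u))) +
      b * gquant (g (b⁻¹ • u))) ≤ h z := fun z hz => by
    by_contra hc; exact hz (subset_toMeasurable _ _ hc)
  classical
  set k : ℝ → ℝ := B.piecewise (fun _ => 1) h with hk
  have hkm : Measurable k := measurable_const.piecewise hBm hh
  have hkh : ∫ x, h x ∂gauss = ∫ x, k x ∂gauss := by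
    refine integral_congr_ae ((gaussianReal_absolutelyContinuous 0 one_ne_zero).ae_le ?_)
    filter_upwards [measure_eq_zero_iff_ae_notMem.1 hB0] with x hx
    rw [hk, Set.piecewise_eq_of_notMem _ _ _ hx]
  have hkI : ∀ x, k x ∈ Set.Icc (0 : ℝ) 1 := fun x => by
    by_cases hx : x ∈ B
    · rw [hk, Set.piecewise_eq_of_mem _ _ _ hx]; simp
    · rw [hk, Set.piecewise_eq_of_notMem _ _ _ hx]; exact hhm x
  have quant : ∀ {a : ℝ} {f : ℝ → ℝ}, Measurable f → (∀ x, f x ∈ Set.Icc ε (1 - ε)) →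
      Measurable (fun y => gquant (f (a⁻¹ * y))) ∧ (∀ y, |gquant (f (a⁻¹ * y))| ≤ L) ∧
      ∀ y, gquant (f (a⁻¹ * y)) ∈ Set.Icc (gquant ε) (gquant (1 - ε)) := by
    intro a f hf hfm
    have h1 : ε ≤ 1 - ε := (hfm 0).1.trans (hfm 0).2
    exact ⟨measurable_gquant.comp (hf.comp (measurable_const_mul _)),
      fun y => (hL _ (hfm _)).1, fun y =>
      ⟨gquant_mono (mem_Ioo_of_mem_Icc hε ⟨le_rfl, h1⟩) (mem_Ioo_of_mem_Icc hε (hfm _)) (hfm _).1,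
       gquant_mono (mem_Ioo_of_mem_Icc hε (hfm _)) (mem_Ioo_of_mem_Icc hε ⟨h1, le_rfl⟩) (hfm _).2⟩⟩
  obtain ⟨hUm, hUL, hUI⟩ := quant (a := a) hf hfm
  obtain ⟨hVm, hVL, hVI⟩ := quant (a := b) hg hgm
  have jet : ∀ n {a : ℝ} {U : ℝ → ℝ}, 0 < a → Measurable U → (∀ y, |U y| ≤ L) →
      (∀ y, U y ∈ Set.Icc (gquant ε) (gquant (1 - ε))) →
      (∃ M f₁ f₂ f₃, BoundedJet M (fun x => gcdf (mollify (bumpKernel n) U (a * x))) f₁ f₂ f₃) ∧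
      ∀ x, gcdf (mollify (bumpKernel n) U (a * x)) ∈ Set.Icc ε (1 - ε) := by
    intro n a U ha hUm hUL hUI
    obtain ⟨M, _, _, _, hJ⟩ := exists_boundedJet_mollify (hasCompactSupport_bumpKernel n)
      (contDiff_bumpKernel n) hUm hUL
    have hmem := mollify_mem_Icc (bumpSeq n).integrable_normed
      (fun t => (bumpSeq n).nonneg_normed t) ((bumpSeq n).integral_normed (μ := volume)) hUm hUI
    have h1 : ε ≤ 1 - ε := (hfm 0).1.trans (hfm 0).2
    refine ⟨(hJ.comp_const_mul ha).gcdf_comp fun x =>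
      abs_le_max_abs_abs (hmem _).1 (hmem _).2, fun x => ⟨?_, ?_⟩⟩
    · have := strictMono_gcdf.monotone (hmem (a * x)).1
      rwa [gcdf_gquant (mem_Ioo_of_mem_Icc hε ⟨le_rfl, h1⟩)] at this
    · have := strictMono_gcdf.monotone (hmem (a * x)).2
      rwa [gcdf_gquant (mem_Ioo_of_mem_Icc hε ⟨h1, le_rfl⟩)] at this
  have hn : ∀ n, gcdf (a * gquant (∫ x, gcdf (mollify (bumpKernel n)
        (fun y => gquant (f (a⁻¹ * y))) (a * x)) ∂gauss) +
      b * gquant (∫ x, gcdf (mollify (bumpKernel n)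
        (fun y => gquant (g (b⁻¹ * y))) (b * x)) ∂gauss)) ≤ ∫ x, h x ∂gauss := by
    intro n
    obtain ⟨⟨M, _, _, _, hJ⟩, hI⟩ := jet n ha hUm hUL hUI
    obtain ⟨⟨M', _, _, _, hJ'⟩, hI'⟩ := jet n hb hVm hVL hVI
    rw [hkh]
    refine ehrhard_of_boundedJet (c := 1) ha hb hρ hρ1 hε (hJ.mono (le_max_left M M'))
      (hJ'.mono (le_max_right M M')) hI hI' hkm (fun z => ?_) fun x y => ?_
    · rw [abs_of_nonneg (hkI z).1]; exact (hkI z).2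
    · rw [gquant_gcdf, gquant_gcdf]
      rcases (hkI (a * x + b * y)).2.eq_or_lt with h1 | h1
      · rw [h1]; exact (gcdf_mem_Ioo _).2.le
      have hz : a * x + b * y ∉ B := fun hz => by
        rw [hk, Set.piecewise_eq_of_mem _ _ _ hz] at h1; exact lt_irrefl _ h1
      have hg := hBg _ hz
      rw [hk, Set.piecewise_eq_of_notMem _ _ _ hz] at h1 ⊢
      have h0 : 0 < h (a * x + b * y) := by
        obtain ⟨u, hu⟩ := hg.exists
        exact (gcdf_mem_Ioo _).1.trans_le hu
      rw [← gcdf_gquant ⟨h0, h1⟩]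
      refine strictMono_gcdf.monotone (mollify_add_mollify_le (bumpSeq n).integrable_normed
        (fun t => (bumpSeq n).nonneg_normed t) ((bumpSeq n).integral_normed (μ := volume))
        (fun t => (bumpSeq n).normed_neg t) hUm hVm hUL hVL ?_)
      filter_upwards [hg] with u hu
      exact (le_gquant_iff ⟨h0, h1⟩).2 hu
  have hmem := fun {f : ℝ → ℝ} (hf : Measurable f) (hfm : ∀ x, f x ∈ Set.Icc ε (1 - ε)) =>
    mem_Ioo_of_mem_Icc hε (integral_mem_Icc_of_mem_Icc (μ := gauss) hf hfm)
  refine le_of_tendsto' ((continuous_gcdf.tendsto _).comp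
    ((((continuousAt_gquant (hmem hf hfm)).tendsto.comp
      (tendsto_integral_gcdf_mollify ha hε hf hfm)).const_mul a).add
    (((continuousAt_gquant (hmem hg hgm)).tendsto.comp
      (tendsto_integral_gcdf_mollify hb hε hg hgm)).const_mul b))) hn

lemma measurableSet_setOf_forall_ae {α β : Type*} [MeasurableSpace α] [MeasurableSpace β]
    {ν : Measure β} [SFinite ν] {p : α → β → Prop} (hp : MeasurableSet {x : α × β | p x.1 x.2}) :
    MeasurableSet {x | ∀ᵐ y ∂ν, p x y} :=
  measurable_measure_prodMk_left hp.compl (measurableSet_singleton 0)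

lemma EhrhardInequality.map {a b : ℝ} {X Y : Type*} [AddCommGroup X] [Module ℝ X]
    [MeasurableSpace X] [AddCommGroup Y] [Module ℝ Y] [MeasurableSpace Y] {ν γ : Measure X}
    {ν' γ' : Measure Y} (H : EhrhardInequality a b ν γ) {e : X → Y}
    (hν : MeasurePreserving e ν ν') (hγ : MeasurePreserving e γ γ')
    (hsub : ∀ x y, e (x - y) = e x - e y) (hsmul : ∀ (c : ℝ) x, e (c • x) = c • e x) :
    EhrhardInequality a b ν' γ' := by
  intro ε hε f g h hf hg hh hfm hgm hhm hyp
  have key : ∀ {f : Y → ℝ}, Measurable f → ∫ y, f y ∂γ' = ∫ x, f (e x) ∂γ := fun hf => by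
    rw [← hγ.map_eq, integral_map hγ.aemeasurable hf.aestronglyMeasurable]
  rw [key hf, key hg, key hh]
  refine H ε hε _ _ _ (hf.comp hγ.measurable) (hg.comp hγ.measurable) (hh.comp hγ.measurable)
    (fun x => hfm _) (fun x => hgm _) (fun x => hhm _) ?_
  filter_upwards [hν.quasiMeasurePreserving.ae hyp] with z hz
  filter_upwards [hν.quasiMeasurePreserving.ae hz] with u hu
  simpa only [hsub, hsmul] using hu

lemma EhrhardInequality.of_unique {a b : ℝ} {X : Type*} [AddCommGroup X] [Module ℝ X]
    [MeasurableSpace X] [Unique X] (ν γ : Measure X) [NeZero ν] [IsProbabilityMeasure γ] :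
    EhrhardInequality a b ν γ := by
  intro ε hε f g h hf hg hh hfm hgm hhm hyp
  obtain ⟨z, hz⟩ := hyp.exists
  obtain ⟨u, hu⟩ := hz.exists
  have key : ∀ (f : X → ℝ) x, ∫ y, f y ∂γ = f x := fun f x => by
    rw [show f = fun _ => f x from funext fun y => by rw [Subsingleton.elim x y]]; simp
  rwa [key f (a⁻¹ • (z - u)), key g (b⁻¹ • u), key h z]

lemma EhrhardInequality.prod {a b : ℝ} {X Y : Type*} [AddCommGroup X] [Module ℝ X]
    [MeasurableSpace X] [MeasurableSub₂ X] [MeasurableConstSMul ℝ X]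
    [AddCommGroup Y] [Module ℝ Y] [MeasurableSpace Y] [MeasurableSub₂ Y] [MeasurableConstSMul ℝ Y]
    {ν γ : Measure X} {ν' γ' : Measure Y} [SFinite ν] [SFinite ν']
    [IsProbabilityMeasure γ] [IsProbabilityMeasure γ']
    (HX : EhrhardInequality a b ν γ) (HY : EhrhardInequality a b ν' γ') :
    EhrhardInequality a b (ν.prod ν') (γ.prod γ') := by
  intro ε hε f g h hf hg hh hfm hgm hhm hyp
  have sec : ∀ {f : X × Y → ℝ} {c d : ℝ}, Measurable f → (∀ p, f p ∈ Set.Icc c d) →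
      Measurable (fun x => ∫ y, f (x, y) ∂γ') ∧ (∀ x, ∫ y, f (x, y) ∂γ' ∈ Set.Icc c d) ∧
      ∫ p, f p ∂(γ.prod γ') = ∫ x, ∫ y, f (x, y) ∂γ' ∂γ := by
    intro f c d hf hfm
    exact ⟨hf.stronglyMeasurable.integral_prod_right'.measurable,
      fun x => integral_mem_Icc_of_mem_Icc (hf.comp measurable_prodMk_left) fun y => hfm _,
      integral_prod _ (integrable_of_measurable_of_bound hf fun p =>
        abs_le_max_abs_abs (hfm p).1 (hfm p).2)⟩
  obtain ⟨hF, hFm, hFi⟩ := sec hf hfm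
  obtain ⟨hG, hGm, hGi⟩ := sec hg hgm
  obtain ⟨hH, hHm, hHi⟩ := sec hh hhm
  rw [hFi, hGi, hHi]
  refine HX ε hε _ _ _ hF hG hH hFm hGm hHm ?_
  filter_upwards [Measure.ae_ae_of_ae_prod hyp] with z hz
  have hz' : ∀ᵐ t ∂ν', ∀ᵐ u ∂ν, ∀ᵐ v ∂ν', gcdf (a * gquant (f (a⁻¹ • (z - u), a⁻¹ • (t - v))) +
      b * gquant (g (b⁻¹ • u, b⁻¹ • v))) ≤ h (z, t) := by
    filter_upwards [hz] with t ht
    exact Measure.ae_ae_of_ae_prod ht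
  have hmeas : MeasurableSet {q : (Y × X) × Y |
      gcdf (a * gquant (f (a⁻¹ • (z - q.1.2), a⁻¹ • (q.1.1 - q.2))) +
      b * gquant (g (b⁻¹ • q.1.2, b⁻¹ • q.2))) ≤ h (z, q.1.1)} := by
    refine measurableSet_le (continuous_gcdf.measurable.comp (Measurable.add
      ((measurable_gquant.comp (hf.comp ?_)).const_mul a)
      ((measurable_gquant.comp (hg.comp ?_)).const_mul b))) (hh.comp ?_)
    · exact ((measurable_const.sub (measurable_snd.comp measurable_fst)).const_smul a⁻¹).prodMk
        (((measurable_fst.comp measurable_fst).sub measurable_snd).const_smul a⁻¹)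
    · exact ((measurable_snd.comp measurable_fst).const_smul b⁻¹).prodMk
        (measurable_snd.const_smul b⁻¹)
    · exact measurable_const.prodMk (measurable_fst.comp measurable_fst)
  have hm := measurableSet_setOf_forall_ae (ν := ν') (p := fun (q : Y × X) v =>
    gcdf (a * gquant (f (a⁻¹ • (z - q.2), a⁻¹ • (q.1 - v))) +
      b * gquant (g (b⁻¹ • q.2, b⁻¹ • v))) ≤ h (z, q.1)) hmeas
  filter_upwards [(Measure.ae_ae_comm hm).1 hz'] with u hu
  exact HY ε hε _ _ _ (hf.comp measurable_prodMk_left) (hg.comp measurable_prodMk_left)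
    (hh.comp measurable_prodMk_left) (fun y => hfm _) (fun y => hgm _) (fun y => hhm _) hu

theorem ehrhardInequality_pi_gauss {a b ρ : ℝ} (ha : 0 < a) (hb : 0 < b)
    (hρ : a ^ 2 + b ^ 2 + 2 * a * b * ρ = 1) (hρ1 : ρ ^ 2 ≤ 1) (n : ℕ) :
    EhrhardInequality a b (volume : Measure (Fin n → ℝ)) (Measure.pi fun _ => gauss) := by
  induction n with
  | zero => exact .of_unique _ _
  | succ n ih =>
    refine ((ehrhardInequality_gauss ha hb hρ hρ1).prod ih).map
      (volume_preserving_piFinSuccAbove (fun _ => ℝ) 0).symm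
      (measurePreserving_piFinSuccAbove (fun _ => gauss) 0).symm (fun x y => ?_) fun c x => ?_
    · ext i
      refine Fin.cases ?_ (fun j => ?_) i <;> simp [MeasurableEquiv.piFinSuccAbove]
    · ext i
      refine Fin.cases ?_ (fun j => ?_) i <;> simp [MeasurableEquiv.piFinSuccAbove]

lemma rpow_two_pi_mul_exp_norm_sq (n : ℕ) (x : Fin n → ℝ) :
    (2 * π) ^ (-(n : ℝ) / 2) * Real.exp (-‖WithLp.toLp 2 x‖ ^ 2 / 2) = ∏ i, gpdf (x i) := by
  simp only [gpdf, Finset.prod_mul_distrib, Finset.prod_const, Finset.card_univ, Fintype.card_fin,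
    ← Real.exp_sum]
  congr 1
  · rw [Real.sqrt_eq_rpow, ← Real.rpow_neg (by positivity), ← Real.rpow_mul_natCast (by positivity)]
    congr 1
    ring
  · rw [EuclideanSpace.norm_sq_eq]
    simp only [norm_eq_abs, sq_abs, ← Finset.sum_div, Finset.sum_neg_distrib]

lemma pi_gauss_eq_withDensity (n : ℕ) : (Measure.pi fun _ : Fin n => gauss) =
    volume.withDensity fun x => ENNReal.ofReal (∏ i, gpdf (x i)) := by
  refine Measure.pi_eq fun s hs => ?_
  have hint : ∀ i, Integrable gpdf (volume.restrict (s i)) := fun i => by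
    rw [funext gpdf_eq]; exact (integrable_gaussianPDFReal 0 1).restrict
  have h1 : ∀ i, gauss (s i) = ENNReal.ofReal (∫ x in s i, gpdf x) := fun i => by
    rw [gaussianReal_apply_eq_integral 0 one_ne_zero, funext gpdf_eq]
  rw [withDensity_apply _ (MeasurableSet.univ_pi hs), volume_pi, Measure.restrict_pi_pi,
    ← ofReal_integral_eq_lintegral_ofReal (Integrable.fintype_prod hint)
      (ae_of_all _ fun x => Finset.prod_nonneg fun i _ => (gpdf_pos _).le),
    integral_fintype_prod_eq_prod (fun _ => gpdf), ENNReal.ofReal_prod_of_nonneg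
      fun i _ => integral_nonneg fun x => (gpdf_pos x).le]
  simp only [h1]

lemma measurePreserving_toLp_pi_gauss (n : ℕ) :
    MeasurePreserving (WithLp.toLp 2) (Measure.pi fun _ : Fin n => gauss) (stdGaussian n) := by
  have hv := PiLp.volume_preserving_toLp (Fin n)
  refine ⟨hv.measurable, ?_⟩
  ext s hs
  rw [Measure.map_apply hv.measurable hs, pi_gauss_eq_withDensity,
    withDensity_apply _ (hv.measurable hs), _root_.stdGaussian, withDensity_apply _ hs]
  simp only [← rpow_two_pi_mul_exp_norm_sq]
  exact hv.setLIntegral_comp_preimage hs (f := fun x : Euc n =>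
    ENNReal.ofReal ((2 * π) ^ (-(n : ℝ) / 2) * Real.exp (-‖x‖ ^ 2 / 2))) (by fun_prop)

instance isProbabilityMeasure_stdGaussian (n : ℕ) : IsProbabilityMeasure (stdGaussian n) := by
  rw [← (measurePreserving_toLp_pi_gauss n).map_eq]
  exact Measure.isProbabilityMeasure_map (measurePreserving_toLp_pi_gauss n).aemeasurable

theorem ehrhardInequality_stdGaussian {a b ρ : ℝ} (ha : 0 < a) (hb : 0 < b)
    (hρ : a ^ 2 + b ^ 2 + 2 * a * b * ρ = 1) (hρ1 : ρ ^ 2 ≤ 1) (n : ℕ) :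
    EhrhardInequality a b (volume : Measure (Euc n)) (stdGaussian n) :=
  (ehrhardInequality_pi_gauss ha hb hρ hρ1 n).map (PiLp.volume_preserving_toLp (Fin n))
    (measurePreserving_toLp_pi_gauss n) (fun _ _ => rfl) fun _ _ => rfl

/-- Ehrhard's function on the closed unit square. -/
def ehrhardFun (a b x y : ℝ) : ℝ :=
  if x = 0 ∨ y = 0 then 0 else if x = 1 ∨ y = 1 then 1 else gcdf (a * gquant x + b * gquant y)

lemma ehrhardFun_mem_Icc (a b x y : ℝ) : ehrhardFun a b x y ∈ Set.Icc (0 : ℝ) 1 := by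
  unfold ehrhardFun
  split_ifs
  · simp
  · simp
  · exact Set.Ioo_subset_Icc_self (gcdf_mem_Ioo _)

lemma ehrhardFun_of_mem_Ioo (a b : ℝ) {x y : ℝ} (hx : x ∈ Set.Ioo (0 : ℝ) 1)
    (hy : y ∈ Set.Ioo (0 : ℝ) 1) : ehrhardFun a b x y = gcdf (a * gquant x + b * gquant y) := by
  rw [ehrhardFun, if_neg (by simp [hx.1.ne', hy.1.ne']), if_neg (by simp [hx.2.ne, hy.2.ne])]

lemma gcdf_add_gquant_mono {a b x y x' y' : ℝ} (ha : 0 < a) (hb : 0 < b)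
    (hx : x ∈ Set.Ioo (0 : ℝ) 1) (hy : y ∈ Set.Ioo (0 : ℝ) 1) (hx' : x' ∈ Set.Ioo (0 : ℝ) 1)
    (hy' : y' ∈ Set.Ioo (0 : ℝ) 1) (hxx : x ≤ x') (hyy : y ≤ y') :
    gcdf (a * gquant x + b * gquant y) ≤ gcdf (a * gquant x' + b * gquant y') := by
  have h1 := gquant_mono hx hx' hxx
  have h2 := gquant_mono hy hy' hyy
  apply strictMono_gcdf.monotone
  gcongr

lemma ehrhardFun_mono {a b x y x' y' : ℝ} (ha : 0 < a) (hb : 0 < b) (hx : 0 ≤ x) (hy : 0 ≤ y)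
    (hx' : x' ≤ 1) (hy' : y' ≤ 1) (hxx : x ≤ x') (hyy : y ≤ y') :
    ehrhardFun a b x y ≤ ehrhardFun a b x' y' := by
  by_cases h0 : x = 0 ∨ y = 0
  · rw [ehrhardFun, if_pos h0]; exact (ehrhardFun_mem_Icc _ _ _ _).1
  push Not at h0
  have hx0 := lt_of_le_of_ne hx h0.1.symm
  have hy0 := lt_of_le_of_ne hy h0.2.symm
  by_cases h1 : x' = 1 ∨ y' = 1
  · rw [ehrhardFun.eq_1 a b x' y', if_neg (by simp [(hx0.trans_le hxx).ne', (hy0.trans_le hyy).ne']),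
      if_pos h1]
    exact (ehrhardFun_mem_Icc _ _ _ _).2
  push Not at h1
  have hx1 := lt_of_le_of_ne hx' h1.1
  have hy1 := lt_of_le_of_ne hy' h1.2
  have m1 : x ∈ Set.Ioo (0 : ℝ) 1 := ⟨hx0, hxx.trans_lt hx1⟩
  have m2 : y ∈ Set.Ioo (0 : ℝ) 1 := ⟨hy0, hyy.trans_lt hy1⟩
  have m3 : x' ∈ Set.Ioo (0 : ℝ) 1 := ⟨hx0.trans_le hxx, hx1⟩
  have m4 : y' ∈ Set.Ioo (0 : ℝ) 1 := ⟨hy0.trans_le hyy, hy1⟩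
  rw [ehrhardFun_of_mem_Ioo _ _ m1 m2, ehrhardFun_of_mem_Ioo _ _ m3 m4]
  exact gcdf_add_gquant_mono ha hb m1 m2 m3 m4 hxx hyy

lemma measurable_ehrhardFun (a b : ℝ) : Measurable fun p : ℝ × ℝ => ehrhardFun a b p.1 p.2 := by
  unfold ehrhardFun
  refine Measurable.ite (((measurableSet_singleton 0).preimage measurable_fst).union
    ((measurableSet_singleton 0).preimage measurable_snd)) measurable_const
    (Measurable.ite (((measurableSet_singleton 1).preimage measurable_fst).union
    ((measurableSet_singleton 1).preimage measurable_snd)) measurable_const ?_)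
  exact continuous_gcdf.measurable.comp (((measurable_gquant.comp measurable_fst).const_mul a).add
    ((measurable_gquant.comp measurable_snd).const_mul b))

section essSup
variable {α β : Type*} [MeasurableSpace α] [MeasurableSpace β] {ν : Measure β}

lemma ae_le_essSup_of_mem_Icc {F : β → ℝ} (hF : ∀ y, F y ∈ Set.Icc (0 : ℝ) 1) :
    ∀ᵐ y ∂ν, F y ≤ essSup F ν :=
  ae_le_essSup ⟨1, eventually_map.2 (ae_of_all _ fun y => (hF y).2)⟩

lemma essSup_le_of_mem_Icc [NeZero ν] {F : β → ℝ} {c : ℝ} (hF : ∀ y, F y ∈ Set.Icc (0 : ℝ) 1)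
    (h : ∀ᵐ y ∂ν, F y ≤ c) : essSup F ν ≤ c :=
  limsup_le_of_le (IsBoundedUnder.isCoboundedUnder_le
    ⟨0, eventually_map.2 (ae_of_all _ fun y => (hF y).1)⟩) h

lemma essSup_mem_Icc [NeZero ν] {F : β → ℝ} (hF : ∀ y, F y ∈ Set.Icc (0 : ℝ) 1) :
    essSup F ν ∈ Set.Icc (0 : ℝ) 1 := by
  refine ⟨?_, essSup_le_of_mem_Icc hF (ae_of_all _ fun y => (hF y).2)⟩
  obtain ⟨y, hy⟩ := (ae_le_essSup_of_mem_Icc (ν := ν) hF).exists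
  exact (hF y).1.trans hy

lemma measurable_essSup [SFinite ν] [NeZero ν] {F : α → β → ℝ}
    (hF : Measurable fun p : α × β => F p.1 p.2)
    (hI : ∀ x y, F x y ∈ Set.Icc (0 : ℝ) 1) : Measurable fun x => essSup (F x) ν := by
  refine measurable_of_Iic fun c => ?_
  have : (fun x => essSup (F x) ν) ⁻¹' Set.Iic c = {x | ∀ᵐ y ∂ν, F x y ≤ c} := by
    ext x
    refine ⟨fun h => ?_, fun h => essSup_le_of_mem_Icc (hI x) h⟩
    filter_upwards [ae_le_essSup_of_mem_Icc (ν := ν) (hI x)] with y hy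
    exact hy.trans h
  rw [this]
  exact measurableSet_setOf_forall_ae (measurableSet_le hF measurable_const)

end essSup

lemma integrable_of_mem_Icc {X : Type*} [MeasurableSpace X] {γ : Measure X} [IsFiniteMeasure γ]
    {f : X → ℝ} (hf : Measurable f) {c d : ℝ}
    (h : ∀ x, f x ∈ Set.Icc c d) : Integrable f γ :=
  integrable_of_measurable_of_bound hf fun x => abs_le_max_abs_abs (h x).1 (h x).2

section closure
variable {a b : ℝ} {X : Type*} [AddCommGroup X] [Module ℝ X] [MeasurableSpace X]
  {ν γ : Measure X} [IsProbabilityMeasure γ] {f g h : X → ℝ}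

lemma EhrhardInequality.of_le_lt_one (H : EhrhardInequality a b ν γ) (ha : 0 < a) (hb : 0 < b)
    {d : ℝ} (hd0 : 0 < d) (hd : d < 1) (hf : Measurable f) (hg : Measurable g) (hh : Measurable h)
    (hfI : ∀ x, f x ∈ Set.Icc 0 d) (hgI : ∀ x, g x ∈ Set.Icc 0 d)
    (hhI : ∀ x, h x ∈ Set.Icc (0 : ℝ) 1) (hA : 0 < ∫ x, f x ∂γ) (hB : 0 < ∫ x, g x ∂γ)
    (hyp : ∀ z, ∀ᵐ u ∂ν, ehrhardFun a b (f (a⁻¹ • (z - u))) (g (b⁻¹ • u)) ≤ h z) :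
    gcdf (a * gquant (∫ x, f x ∂γ) + b * gquant (∫ x, g x ∂γ)) ≤ ∫ x, h x ∂γ := by
  set θ : ℝ → ℝ := fun ε => gcdf (a * gquant ε + b * gquant d) +
    gcdf (a * gquant d + b * gquant ε) with hθ
  have hθ0 : ∀ ε, 0 ≤ θ ε := fun ε => add_nonneg (gcdf_mem_Ioo _).1.le (gcdf_mem_Ioo _).1.le
  have hθlim : Tendsto (fun ε => ∫ x, h x ∂γ + θ ε) (𝓝[>] 0) (𝓝 (∫ x, h x ∂γ + (0 + 0))) := by
    refine tendsto_const_nhds.add (Tendsto.add ?_ ?_)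
    · exact tendsto_gcdf_atBot.comp (tendsto_atBot_add_const_right _ _
        (tendsto_gquant_zero.const_mul_atBot ha))
    · exact tendsto_gcdf_atBot.comp (tendsto_atBot_add_const_left _ _
        (tendsto_gquant_zero.const_mul_atBot hb))
  rw [add_zero, add_zero] at hθlim
  have hev : ∀ᶠ ε in 𝓝[>] (0 : ℝ), ε < min d (1 - d) :=
    (eventually_lt_nhds (lt_min hd0 (by linarith))).filter_mono nhdsWithin_le_nhds
  refine ge_of_tendsto hθlim ?_
  filter_upwards [hev, self_mem_nhdsWithin] with ε hε hε0
  have hε0 : 0 < ε := hε0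
  have hεd : ε < d := hε.trans_le (min_le_left _ _)
  have hεd' : ε < 1 - d := hε.trans_le (min_le_right _ _)
  have dIoo : d ∈ Set.Ioo (0 : ℝ) 1 := ⟨hd0, hd⟩
  have εIoo : ε ∈ Set.Ioo (0 : ℝ) 1 := ⟨hε0, hεd.trans hd⟩
  have trunc : ∀ {f : X → ℝ}, Measurable f → (∀ x, f x ∈ Set.Icc 0 d) → 0 < ∫ x, f x ∂γ →
      Measurable (fun x => max (f x) ε) ∧ (∀ x, max (f x) ε ∈ Set.Icc ε (1 - ε)) ∧
      (∀ x, max (f x) ε ∈ Set.Ioo (0 : ℝ) 1) ∧ (∀ x, max (f x) ε ≤ d) ∧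
      ∫ x, f x ∂γ ∈ Set.Ioo (0 : ℝ) 1 ∧ ∫ x, f x ∂γ ≤ ∫ x, max (f x) ε ∂γ := by
    intro f hf hfI hA
    have hm : Measurable (fun x => max (f x) ε) := hf.max measurable_const
    have hle : ∀ x, max (f x) ε ≤ d := fun x => max_le (hfI x).2 hεd.le
    have hI : ∀ x, max (f x) ε ∈ Set.Icc ε (1 - ε) := fun x =>
      ⟨le_max_right _ _, (hle x).trans (by linarith)⟩
    exact ⟨hm, hI, fun x => mem_Ioo_of_mem_Icc hε0 (hI x), hle,
      ⟨hA, (integral_mem_Icc_of_mem_Icc hf hfI).2.trans_lt hd⟩,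
      integral_mono (integrable_of_mem_Icc hf hfI) (integrable_of_mem_Icc hm hI)
        fun x => le_max_left _ _⟩
  obtain ⟨f1, f2, f3, f4, f5, f6⟩ := trunc hf hfI hA
  obtain ⟨g1, g2, g3, g4, g5, g6⟩ := trunc hg hgI hB
  have hkI : ∀ x, min (h x + θ ε) 1 ∈ Set.Icc (0 : ℝ) 1 := fun x =>
    ⟨le_min (add_nonneg (hhI x).1 (hθ0 ε)) zero_le_one, min_le_right _ _⟩
  have hkm : Measurable fun x => min (h x + θ ε) 1 := (hh.add_const _).min measurable_const
  have main := H ε hε0 _ _ _ f1 g1 hkm f2 g2 hkI (ae_of_all _ fun z => by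
    filter_upwards [hyp z] with u hu
    refine le_min ?_ (gcdf_mem_Ioo _).2.le
    rcases lt_or_ge (f (a⁻¹ • (z - u))) ε with h1 | h1
    · rw [max_eq_right h1.le]
      have := gcdf_add_gquant_mono ha hb εIoo (g3 (b⁻¹ • u)) εIoo dIoo le_rfl (g4 _)
      have h3 := (gcdf_mem_Ioo (a * gquant d + b * gquant ε)).1
      have h4 := (hhI z).1
      simp only [hθ]
      linarith
    rcases lt_or_ge (g (b⁻¹ • u)) ε with h2 | h2
    · rw [max_eq_right h2.le]
      have := gcdf_add_gquant_mono ha hb (f3 (a⁻¹ • (z - u))) εIoo dIoo εIoo (f4 _) le_rfl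
      have h3 := (gcdf_mem_Ioo (a * gquant ε + b * gquant d)).1
      have h4 := (hhI z).1
      simp only [hθ]
      linarith
    have m1 := f3 (a⁻¹ • (z - u))
    have m2 := g3 (b⁻¹ • u)
    rw [max_eq_left h1] at m1 ⊢
    rw [max_eq_left h2] at m2 ⊢
    rw [ehrhardFun_of_mem_Ioo _ _ m1 m2] at hu
    linarith [hθ0 ε])
  have f7 := mem_Ioo_of_mem_Icc hε0 (integral_mem_Icc_of_mem_Icc (μ := γ) f1 f2)
  have g7 := mem_Ioo_of_mem_Icc hε0 (integral_mem_Icc_of_mem_Icc (μ := γ) g1 g2)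
  have hhi : Integrable h γ := integrable_of_mem_Icc hh hhI
  calc _ ≤ _ := gcdf_add_gquant_mono ha hb f5 g5 f7 g7 f6 g6
    _ ≤ _ := main
    _ ≤ ∫ x, (h x + θ ε) ∂γ := integral_mono (integrable_of_mem_Icc hkm hkI)
        (hhi.add (integrable_const _)) fun x => min_le_left _ _
    _ = _ := by rw [integral_add hhi (integrable_const _)]; simp

lemma tendsto_gcdf_add_gquant_scale {A B : ℝ} (ha : 0 < a) (hb : 0 < b)
    (hA : A ∈ Set.Ioc (0 : ℝ) 1) (hB : B ∈ Set.Ioc (0 : ℝ) 1) :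
    Tendsto (fun c => gcdf (a * gquant (c * A) + b * gquant (c * B))) (𝓝[<] 1)
      (𝓝 (ehrhardFun a b A B)) := by
  have one : Tendsto (fun c => gquant (c * 1)) (𝓝[<] 1) atTop := by
    simpa only [mul_one] using tendsto_gquant_one
  have cont : ∀ {A : ℝ}, A ∈ Set.Ioo (0 : ℝ) 1 →
      Tendsto (fun c => gquant (c * A)) (𝓝[<] 1) (𝓝 (gquant A)) := fun {A} hA => by
    have h1 : Tendsto (fun c => c * A) (𝓝[<] 1) (𝓝 (1 * A)) :=
      (tendsto_id.mono_left nhdsWithin_le_nhds).mul_const A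
    rw [one_mul] at h1
    exact (continuousAt_gquant hA).tendsto.comp h1
  have top : Tendsto (fun c => a * gquant (c * A) + b * gquant (c * B)) (𝓝[<] 1) atTop →
      (A = 1 ∨ B = 1) → Tendsto (fun c => gcdf (a * gquant (c * A) + b * gquant (c * B))) (𝓝[<] 1)
      (𝓝 (ehrhardFun a b A B)) := fun h h1 => by
    rw [ehrhardFun, if_neg (by simp [hA.1.ne', hB.1.ne']), if_pos h1]
    exact tendsto_gcdf_atTop.comp h
  rcases hA.2.eq_or_lt with hA1 | hA1 <;> rcases hB.2.eq_or_lt with hB1 | hB1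
  · refine top ?_ (.inl hA1)
    rw [hA1, hB1]
    exact (one.const_mul_atTop ha).atTop_add_atTop (one.const_mul_atTop hb)
  · refine top ?_ (.inl hA1)
    rw [hA1]
    exact (one.const_mul_atTop ha).atTop_add ((cont ⟨hB.1, hB1⟩).const_mul b)
  · refine top ?_ (.inr hB1)
    rw [hB1]
    exact ((cont ⟨hA.1, hA1⟩).const_mul a).add_atTop (one.const_mul_atTop hb)
  · rw [ehrhardFun_of_mem_Ioo _ _ ⟨hA.1, hA1⟩ ⟨hB.1, hB1⟩]
    exact (continuous_gcdf.tendsto _).comp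
      (((cont ⟨hA.1, hA1⟩).const_mul a).add ((cont ⟨hB.1, hB1⟩).const_mul b))

lemma EhrhardInequality.ehrhardFun_integral_le (H : EhrhardInequality a b ν γ) (ha : 0 < a)
    (hb : 0 < b) (hf : Measurable f) (hg : Measurable g) (hh : Measurable h)
    (hfI : ∀ x, f x ∈ Set.Icc (0 : ℝ) 1) (hgI : ∀ x, g x ∈ Set.Icc (0 : ℝ) 1)
    (hhI : ∀ x, h x ∈ Set.Icc (0 : ℝ) 1)
    (hyp : ∀ z, ∀ᵐ u ∂ν, ehrhardFun a b (f (a⁻¹ • (z - u))) (g (b⁻¹ • u)) ≤ h z) :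
    ehrhardFun a b (∫ x, f x ∂γ) (∫ x, g x ∂γ) ≤ ∫ x, h x ∂γ := by
  have hA := integral_mem_Icc_of_mem_Icc (μ := γ) hf hfI
  have hB := integral_mem_Icc_of_mem_Icc (μ := γ) hg hgI
  by_cases h0 : ∫ x, f x ∂γ = 0 ∨ ∫ x, g x ∂γ = 0
  · rw [ehrhardFun, if_pos h0]
    exact integral_nonneg fun x => (hhI x).1
  push Not at h0
  have hA0 := lt_of_le_of_ne hA.1 h0.1.symm
  have hB0 := lt_of_le_of_ne hB.1 h0.2.symm
  refine le_of_tendsto (tendsto_gcdf_add_gquant_scale ha hb ⟨hA0, hA.2⟩ ⟨hB0, hB.2⟩) ?_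
  have hev : ∀ᶠ c in 𝓝[<] (1 : ℝ), 0 < c :=
    (eventually_gt_nhds zero_lt_one).filter_mono nhdsWithin_le_nhds
  filter_upwards [hev, self_mem_nhdsWithin] with c hc0 hc1
  have hc1 : c < 1 := hc1
  have scale : ∀ {f : X → ℝ}, (∀ x, f x ∈ Set.Icc (0 : ℝ) 1) → ∀ x, c * f x ∈ Set.Icc 0 c :=
    fun hfI x => ⟨mul_nonneg hc0.le (hfI x).1, mul_le_of_le_one_right hc0.le (hfI x).2⟩
  rw [← integral_const_mul, ← integral_const_mul]
  refine H.of_le_lt_one ha hb hc0 hc1 (hf.const_mul c) (hg.const_mul c) hh (scale hfI) (scale hgI)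
    hhI (by rw [integral_const_mul]; positivity) (by rw [integral_const_mul]; positivity)
    fun z => ?_
  filter_upwards [hyp z] with u hu
  exact (ehrhardFun_mono ha hb (scale hfI _).1 (scale hgI _).1 (hfI _).2 (hgI _).2
    (mul_le_of_le_one_left (hfI _).1 hc1.le) (mul_le_of_le_one_left (hgI _).1 hc1.le)).trans hu

end closure

end

/-- the functional Ehrhard inequality for the standard Gaussian measure. -/
theorem stmt9 (a b : ℝ) (ha : 0 < a) (hb : 0 < b) (hab1 : 1 ≤ a + b) (hab2 : |a - b| ≤ 1)
    (Ψ : ℝ → ℝ)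
    (hΨ : ∀ s, Ψ s = ∫ t in Set.Iic s, (2 * π) ^ (-(1 : ℝ) / 2) * Real.exp (-t ^ 2 / 2))
    (Ψi : ℝ → ℝ) (hΨi : ∀ x ∈ Set.Ioo (0 : ℝ) 1, Ψ (Ψi x) = x)
    (H : ℝ × ℝ → ℝ)
    (hHdef : ∀ x y : ℝ, H (x, y) =
      if x = 0 ∨ y = 0 then 0
      else if x = 1 ∨ y = 1 then 1
      else Ψ (a * Ψi x + b * Ψi y))
    (n : ℕ) (hn : 1 ≤ n)
    (f g : Euc n → ℝ) (hf : Measurable f) (hg : Measurable g)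
    (hf1 : ∀ x, f x ∈ Set.Icc (0 : ℝ) 1) (hg1 : ∀ y, g y ∈ Set.Icc (0 : ℝ) 1) :
    H (∫ x, f x ∂(stdGaussian n), ∫ x, g x ∂(stdGaussian n)) ≤
      ∫ x, essSup (fun y => H (f (a⁻¹ • (x - y)), g (b⁻¹ • y))) volume
        ∂(stdGaussian n) := by
  have hΨ' : ∀ s, Ψ s = gcdf s := fun s => by
    rw [hΨ, gcdf]
    congr 1
    ext t
    rw [gpdf, Real.sqrt_eq_rpow, ← Real.rpow_neg (by positivity)]
    norm_num
  have hΨi' : ∀ x ∈ Set.Ioo (0 : ℝ) 1, Ψi x = gquant x := fun x hx =>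
    strictMono_gcdf.injective (by rw [← hΨ', hΨi x hx, gcdf_gquant hx])
  have hH : ∀ x ∈ Set.Icc (0 : ℝ) 1, ∀ y ∈ Set.Icc (0 : ℝ) 1,
      H (x, y) = ehrhardFun a b x y := by
    intro x hx y hy
    rw [hHdef, ehrhardFun]
    split_ifs with h0 h1
    · rfl
    · rfl
    · push Not at h0 h1
      rw [hΨ', hΨi' x ⟨lt_of_le_of_ne hx.1 h0.1.symm, lt_of_le_of_ne hx.2 h1.1⟩,
        hΨi' y ⟨lt_of_le_of_ne hy.1 h0.2.symm, lt_of_le_of_ne hy.2 h1.2⟩]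
  rw [hH _ (integral_mem_Icc_of_mem_Icc hf hf1) _ (integral_mem_Icc_of_mem_Icc hg hg1)]
  simp only [hH _ (hf1 _) _ (hg1 _)]
  have hρ : a ^ 2 + b ^ 2 + 2 * a * b * ((1 - a ^ 2 - b ^ 2) / (2 * a * b)) = 1 := by
    field_simp; ring
  have hρ1 : ((1 - a ^ 2 - b ^ 2) / (2 * a * b)) ^ 2 ≤ 1 := by
    rw [div_pow, div_le_one (by positivity)]
    refine sq_le_sq' ?_ ?_
    · nlinarith [abs_le.1 hab2]
    · nlinarith
  have hFI : ∀ z u : Euc n, ehrhardFun a b (f (a⁻¹ • (z - u))) (g (b⁻¹ • u)) ∈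
    Set.Icc (0 : ℝ) 1 := fun z u => ehrhardFun_mem_Icc _ _ _ _
  refine (ehrhardInequality_stdGaussian ha hb hρ hρ1 n).ehrhardFun_integral_le ha hb hf hg
    (measurable_essSup ?_ hFI) hf1 hg1 (fun z => essSup_mem_Icc (hFI z))
    fun z => ae_le_essSup_of_mem_Icc (hFI z)
  exact (measurable_ehrhardFun a b).comp
    ((hf.comp ((measurable_fst.sub measurable_snd).const_smul a⁻¹)).prodMk
      (hg.comp (measurable_snd.const_smul b⁻¹)))

end
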